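/- Let A = KQ/I be a finite-dimensional algebra over an algebraically closed field K, where Q is a finite quiver and I is an admissible ideal of KQ, and assume that A has finite global dimension. Then A is geometrically irreducible if and only if A is hereditary (i.e. the global dimension of A is at most 1). -/

import Mathlib

open scoped BigOperators

noncomputable section
/-! ## Quivers and paths -/

/-- A finite quiver: finite sets of vertices and arrows together with source and
target maps. -/
structure FinQuiver : Type 1 where
  V : Type
  A : Type
  [fintypeV : Fintype V]
  [fintypeA : Fintype A]
  [decEqV : DecidableEq V]
  [decEqA : DecidableEq A]
  src : A → V
  tgt : A → V

attribute [instance] FinQuiver.fintypeV FinQuiver.fintypeA FinQuiver.decEqV FinQuiver.decEqA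

/-- A path of positive length in a quiver: a list of composable arrows `[a₁, …, aₘ]`
satisfying `s (aᵢ) = t (aᵢ₊₁)`. -/
structure QPath (Q : FinQuiver) : Type where
  arrows : List Q.A
  ne : arrows ≠ []
  chain : arrows.Chain' fun a b => Q.src a = Q.tgt b

namespace QPath

variable {Q : FinQuiver}

/-- The length of a path. -/
def length (p : QPath Q) : ℕ := p.arrows.length

/-- The target `t (a₁)` of a path `(a₁, …, aₘ)`. -/
def tgt (p : QPath Q) : Q.V := Q.tgt (p.arrows.head p.ne)

/-- The source `s (aₘ)` of a path `(a₁, …, aₘ)`. -/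
def src (p : QPath Q) : Q.V := Q.src (p.arrows.getLast p.ne)

/-- A path is a cycle if its source equals its target. -/
def IsCycle (p : QPath Q) : Prop := p.src = p.tgt

/-- A cycle `(a₁, …, aₘ)` is primitive if the vertices `s (a₁), …, s (aₘ)` are pairwise
different. -/
def IsPrimitive (p : QPath Q) : Prop := (p.arrows.map Q.src).Nodup

end QPath

/-! ## The path algebra, relations, admissible ideals and representation varieties -/

/-- The defining relations presenting the path algebra `KQ` as a quotient of the free
algebra on the vertices and arrows of `Q`: the vertices become a complete set of
orthogonal idempotents summing to `1`, and `e_{t(a)} * a = a = a * e_{s(a)}` for every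
arrow `a`. -/
inductive PathRel (K : Type) [Field K] (Q : FinQuiver) :
    FreeAlgebra K (Q.V ⊕ Q.A) → FreeAlgebra K (Q.V ⊕ Q.A) → Prop
  | idem (i : Q.V) : PathRel K Q
      (FreeAlgebra.ι K (Sum.inl i) * FreeAlgebra.ι K (Sum.inl i)) (FreeAlgebra.ι K (Sum.inl i))
  | orth (i j : Q.V) (h : i ≠ j) : PathRel K Q
      (FreeAlgebra.ι K (Sum.inl i) * FreeAlgebra.ι K (Sum.inl j)) 0
  | sum_one : PathRel K Q (∑ i : Q.V, FreeAlgebra.ι K (Sum.inl i)) 1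
  | tgt_mul (a : Q.A) : PathRel K Q
      (FreeAlgebra.ι K (Sum.inl (Q.tgt a)) * FreeAlgebra.ι K (Sum.inr a))
      (FreeAlgebra.ι K (Sum.inr a))
  | mul_src (a : Q.A) : PathRel K Q
      (FreeAlgebra.ι K (Sum.inr a) * FreeAlgebra.ι K (Sum.inl (Q.src a)))
      (FreeAlgebra.ι K (Sum.inr a))

/-- The path algebra `KQ`. -/
abbrev PathAlgebra (K : Type) [Field K] (Q : FinQuiver) : Type := RingQuot (PathRel K Q)

variable (K : Type) [Field K] (Q : FinQuiver)

/-- The idempotent `eᵢ ∈ KQ` corresponding to a vertex `i` (the path of length zero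
at `i`). -/
def vertexElem (i : Q.V) : PathAlgebra K Q :=
  RingQuot.mkAlgHom K (PathRel K Q) (FreeAlgebra.ι K (Sum.inl i))

/-- The element of `KQ` corresponding to an arrow `a`. -/
def arrowElem (a : Q.A) : PathAlgebra K Q :=
  RingQuot.mkAlgHom K (PathRel K Q) (FreeAlgebra.ι K (Sum.inr a))

/-- The element of `KQ` corresponding to a path `(a₁, …, aₘ)`, namely `a₁ ⋯ aₘ`. -/
def pathElem (p : QPath Q) : PathAlgebra K Q := (p.arrows.map (arrowElem K Q)).prod

/-- The element `∑ₚ c p • p` of `KQ` determined by a finitely supported family of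
coefficients on paths. -/
def relElem (c : QPath Q →₀ K) : PathAlgebra K Q := c.sum fun p l => l • pathElem K Q p

/-- `c` is the datum of a relation with common target `i` and common source `j`: all
paths in its support have length at least two, target `i` and source `j`.  (The paths in
the support are pairwise different and have nonzero coefficients by definition of a
finitely supported function.) -/
def IsRelationData (c : QPath Q →₀ K) (i j : Q.V) : Prop :=
  ∀ p ∈ c.support, 2 ≤ p.length ∧ p.tgt = i ∧ p.src = j

/-- An element of `KQ` is a relation if it is a `K`-linear combination `∑ λₚ • p` of
pairwise different paths of length at least two having a common source and a common
target, with all `λₚ ≠ 0`. -/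
def IsRelation (x : PathAlgebra K Q) : Prop :=
  ∃ (c : QPath Q →₀ K) (i j : Q.V), IsRelationData K Q c i j ∧ x = relElem K Q c

/-- The two-sided ideal generated by a set `S`, as a set: the additive subgroup generated
by all elements `a * s * b` with `s ∈ S`. -/
def twoSidedSpan (R : Type) [Ring R] (S : Set R) : Set R :=
  (AddSubgroup.closure {x | ∃ a b : R, ∃ s ∈ S, x = a * s * b} : AddSubgroup R)

/-- `φ : KQ →ₐ[K] A` presents `A` as `KQ/I` with `I = ker φ` an admissible ideal:
`φ` is surjective, its kernel is generated (as a two-sided ideal) by a set of relations,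
and there is some `m ≥ 2` such that all paths of length at least `m` lie in the kernel. -/
def IsAdmissiblePresentation {A : Type} [Ring A] [Algebra K A]
    (φ : PathAlgebra K Q →ₐ[K] A) : Prop :=
  Function.Surjective φ ∧
  (∃ S : Set (PathAlgebra K Q), (∀ x ∈ S, IsRelation K Q x) ∧
    twoSidedSpan (PathAlgebra K Q) S = {x | φ x = 0}) ∧
  ∃ m : ℕ, 2 ≤ m ∧ ∀ p : QPath Q, m ≤ p.length → φ (pathElem K Q p) = 0

/-- The index type for the rows/columns of the matrices in a `d`-dimensional
representation: the basis vectors of `⊕ᵢ K^{dᵢ}`. -/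
abbrev RepIx (d : Q.V → ℕ) : Type := (i : Q.V) × Fin (d i)

/-- The ambient affine space of `d`-dimensional representations.  An arrow `a` gets a
matrix; membership in `RepSet` forces the matrix of `a` to be concentrated in the block
with rows indexed by the block `t(a)` and columns indexed by the block `s(a)`, i.e. to be
(the block extension of) a `d (t a) × d (s a)`-matrix. -/
abbrev RepSpace (d : Q.V → ℕ) : Type := Q.A → Matrix (RepIx Q d) (RepIx Q d) K

/-- The Zariski topology on affine space `K^ι`: generated by the complements of zero sets
of polynomials in the coordinates. -/
def zariskiTopology (ι R : Type) [CommSemiring R] : TopologicalSpace (ι → R) :=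
  TopologicalSpace.generateFrom
    {U | ∃ f : MvPolynomial ι R, U = {x | MvPolynomial.eval x f ≠ 0}}

/-- The Zariski topology on the ambient space of `d`-dimensional representations. -/
def repTopology (d : Q.V → ℕ) : TopologicalSpace (RepSpace K Q d) :=
  TopologicalSpace.induced (fun M (x : Q.A × RepIx Q d × RepIx Q d) => M x.1 x.2.1 x.2.2)
    (zariskiTopology (Q.A × RepIx Q d × RepIx Q d) K)

/-- The condition that the matrix of each arrow `a` is concentrated in the
`(t a, s a)`-block, i.e. really is a `d (t a) × d (s a)`-matrix. -/
def BlockCompatible (d : Q.V → ℕ) (M : RepSpace K Q d) : Prop :=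
  ∀ (a : Q.A) (u v : RepIx Q d), M a u v ≠ 0 → u.1 = Q.tgt a ∧ v.1 = Q.src a

/-- The evaluation `M(p) = M(a₁) ⋯ M(aₘ)` of a representation at a path. -/
def pathProd (d : Q.V → ℕ) (M : RepSpace K Q d) (p : QPath Q) :
    Matrix (RepIx Q d) (RepIx Q d) K := (p.arrows.map M).prod

/-- The evaluation `M(ρ) = ∑ λₚ M(p)` of a representation at a linear combination of
paths. -/
def relEval (d : Q.V → ℕ) (M : RepSpace K Q d) (c : QPath Q →₀ K) :
    Matrix (RepIx Q d) (RepIx Q d) K := c.sum fun p l => l • pathProd K Q d M p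

/-- The affine variety `rep(A, d)` of `d`-dimensional representations of `A = KQ/I`,
where `I = ker φ`: tuples of matrices (of the correct block sizes) with `M(ρ) = 0` for
every relation `ρ ∈ I`. -/
def RepSet {A : Type} [Ring A] [Algebra K A] (φ : PathAlgebra K Q →ₐ[K] A) (d : Q.V → ℕ) :
    Set (RepSpace K Q d) :=
  {M | BlockCompatible K Q d M ∧
    ∀ (c : QPath Q →₀ K) (i j : Q.V), IsRelationData K Q c i j →
      φ (relElem K Q c) = 0 → relEval K Q d M c = 0}

/-- `A = KQ/I` (presented by `φ`, with `I = ker φ`) is geometrically irreducible if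
`rep(A, d)` is an irreducible topological space for every dimension vector `d`. -/
def IsGeomIrreducible {A : Type} [Ring A] [Algebra K A] (φ : PathAlgebra K Q →ₐ[K] A) :
    Prop :=
  ∀ d : Q.V → ℕ, @IsIrreducible _ (repTopology K Q d) (RepSet K Q φ d)

/-! ## Projective and injective dimension -/

/-- `HasProjDimLE A n M` : the `A`-module `M` has projective dimension at most `n`,
i.e. there is a projective resolution `0 → Pₙ → ⋯ → P₀ → M → 0`. -/
def HasProjDimLE (A : Type) [Ring A] : ℕ → ModuleCat.{0} A → Prop
  | 0, M => Module.Projective A M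
  | n + 1, M => ∃ (P : ModuleCat.{0} A) (f : P →ₗ[A] M), Module.Projective A P ∧
      Function.Surjective f ∧ HasProjDimLE A n (ModuleCat.of A ↥(LinearMap.ker f))

/-- `HasInjDimLE A n M` : the `A`-module `M` has injective dimension at most `n`,
i.e. there is an injective coresolution `0 → M → I⁰ → ⋯ → Iⁿ → 0`. -/
def HasInjDimLE (A : Type) [Ring A] : ℕ → ModuleCat.{0} A → Prop
  | 0, M => Module.Injective A M
  | n + 1, M => ∃ (I : ModuleCat.{0} A) (f : M →ₗ[A] I), Module.Injective A I ∧
      Function.Injective f ∧ HasInjDimLE A n (ModuleCat.of A (↥I ⧸ LinearMap.range f))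

/-- A ring is hereditary iff its (left) global dimension is at most one, i.e. every
module has projective dimension at most `1`. -/
def IsHereditaryRing (A : Type) [Ring A] : Prop :=
  ∀ M : ModuleCat.{0} A, HasProjDimLE A 1 M

/-- A ring has finite (left) global dimension if there is a simultaneous bound on the
projective dimensions of all modules. -/
def HasFiniteGlobalDimension (A : Type) [Ring A] : Prop :=
  ∃ n : ℕ, ∀ M : ModuleCat.{0} A, HasProjDimLE A n M

section ProjectiveDimension

open CategoryTheory

variable {A : Type} [Ring A]

/-- The `A`-module `M` has projective dimension less than `n`. -/
abbrev ProjDimLT (A M : Type) [Ring A] [AddCommGroup M] [Module A M] (n : ℕ) : Prop :=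
  HasProjectiveDimensionLT (ModuleCat.of A M) n

variable {M N : Type} [AddCommGroup M] [Module A M] [AddCommGroup N] [Module A N]

theorem projDimLT_one_iff : ProjDimLT A M 1 ↔ Module.Projective A M := by
  rw [ProjDimLT, ← projective_iff_hasProjectiveDimensionLT_one, ← IsProjective.iff_projective]

theorem projDimLT_of_ker {f : M →ₗ[A] N} (hf : Function.Surjective f) {n : ℕ}
    (hker : ProjDimLT A (LinearMap.ker f) n) (hM : ProjDimLT A M (n + 1)) :
    ProjDimLT A N (n + 1) :=
  (LinearMap.shortExact_shortComplexKer hf).hasProjectiveDimensionLT_X₃ n hker hM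

theorem projDimLT_ker {f : M →ₗ[A] N} (hf : Function.Surjective f) {n : ℕ}
    (hM : ProjDimLT A M n) (hN : ProjDimLT A N (n + 1)) : ProjDimLT A (LinearMap.ker f) n :=
  (LinearMap.shortExact_shortComplexKer hf).hasProjectiveDimensionLT_X₁ n hM hN

theorem projDimLT_extension {f : M →ₗ[A] N} (hf : Function.Surjective f) {n : ℕ}
    (hker : ProjDimLT A (LinearMap.ker f) n) (hN : ProjDimLT A N n) : ProjDimLT A M n :=
  (LinearMap.shortExact_shortComplexKer hf).hasProjectiveDimensionLT_X₂ n hker hN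

theorem ProjDimLT.of_equiv (e : M ≃ₗ[A] N) {n : ℕ} (h : ProjDimLT A M n) : ProjDimLT A N n :=
  hasProjectiveDimensionLT_of_iso e.toModuleIso n

theorem ProjDimLT.succ {n : ℕ} (h : ProjDimLT A M n) : ProjDimLT A M (n + 1) :=
  hasProjectiveDimensionLT_of_ge (ModuleCat.of A M) n (n + 1) n.le_succ

theorem projDimLT_of_projective [Module.Projective A M] (n : ℕ) : ProjDimLT A M (n + 1) := by
  induction n with
  | zero => exact projDimLT_one_iff.2 ‹_›
  | succ n ih => exact ih.succ

theorem HasProjDimLE.projDimLT {n : ℕ} {M : ModuleCat.{0} A} (h : HasProjDimLE A n M) :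
    ProjDimLT A M (n + 1) := by
  induction n generalizing M with
  | zero => exact projDimLT_one_iff.2 h
  | succ n ih =>
    obtain ⟨P, f, hP, hf, hker⟩ := h
    exact projDimLT_of_ker hf (ih hker) (projDimLT_of_projective _)

theorem ProjDimLT.hasProjDimLE_one {M : ModuleCat.{0} A} (h : ProjDimLT A M 2) :
    HasProjDimLE A 1 M := by
  have hs : Function.Surjective (Finsupp.linearCombination A (id : M → M)) :=
    Finsupp.linearCombination_id_surjective A M
  exact ⟨ModuleCat.of A (M →₀ A), Finsupp.linearCombination A (id : M → M),
    (inferInstance : Module.Projective A (M →₀ A)), hs,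
    projDimLT_one_iff.1 (projDimLT_ker hs (projDimLT_of_projective 0) h)⟩

end ProjectiveDimension

set_option linter.unusedSectionVars false
section WeightSpaces

variable {K A : Type} [Field K] [Ring A] [Algebra K A]
variable {M N : Type} [AddCommGroup M] [Module K M] [Module A M] [IsScalarTower K A M]
  [AddCommGroup N] [Module K N] [Module A N] [IsScalarTower K A N]

/-- The subspace of elements of `M` fixed by `x`; for an idempotent `x` this is `x M`. -/
def fixedSpace (K M : Type) {A : Type} [Field K] [Ring A] [Algebra K A] [AddCommGroup M]
    [Module K M] [Module A M] [IsScalarTower K A M] (x : A) : Submodule K M where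
  carrier := {m | x • m = m}
  add_mem' {a b} ha hb := by
    simp only [Set.mem_ofPred_eq] at ha hb ⊢
    rw [smul_add, ha, hb]
  zero_mem' := smul_zero x
  smul_mem' c m hm := by
    simp only [Set.mem_ofPred_eq] at hm ⊢
    rw [← algebraMap_smul A c m, ← mul_smul, ← Algebra.commutes, mul_smul, hm]

@[simp] theorem mem_fixedSpace {x : A} {m : M} : m ∈ fixedSpace K M x ↔ x • m = m := Iff.rfl

theorem smul_mem_fixedSpace {x : A} (hx : x * x = x) (m : M) : x • m ∈ fixedSpace K M x := by
  rw [mem_fixedSpace, ← mul_smul, hx]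

theorem finrank_fixedSpace_eq_add_ker [FiniteDimensional K M] {x : A} (hx : x * x = x)
    {f : M →ₗ[A] N} (hf : Function.Surjective f) :
    Module.finrank K (fixedSpace K M x) =
      Module.finrank K (fixedSpace K N x) +
        Module.finrank K (fixedSpace K (LinearMap.ker f) x) := by
  have hmaps : ∀ m ∈ fixedSpace K M x, f.restrictScalars K m ∈ fixedSpace K N x := by
    intro m hm
    rw [mem_fixedSpace] at hm
    rw [mem_fixedSpace, LinearMap.restrictScalars_apply, ← map_smul, hm]
  let g := (f.restrictScalars K).restrict hmaps
  have hg : Function.Surjective g := by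
    rintro ⟨n, hn⟩
    obtain ⟨m, rfl⟩ := hf n
    refine ⟨⟨x • m, smul_mem_fixedSpace hx m⟩, Subtype.ext ?_⟩
    rw [mem_fixedSpace] at hn
    change f (x • m) = f m
    rw [map_smul, hn]
  let E : LinearMap.ker g ≃ₗ[K] fixedSpace K (LinearMap.ker f) x :=
    { toFun := fun m => ⟨⟨m.1.1, congrArg Subtype.val (LinearMap.mem_ker.1 m.2)⟩,
        Subtype.ext m.1.2⟩
      invFun := fun m => ⟨⟨m.1.1, congrArg Subtype.val m.2⟩, Subtype.ext m.1.2⟩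
      map_add' := fun _ _ => rfl
      map_smul' := fun _ _ => rfl
      left_inv := fun _ => rfl
      right_inv := fun _ => rfl }
  rw [← E.finrank_eq, ← LinearMap.finrank_range_add_finrank_ker g,
    LinearMap.range_eq_top.2 hg, finrank_top]

theorem finrank_fixedSpace_pi {L : Type} [Fintype L] {P : L → Type} [∀ l, AddCommGroup (P l)]
    [∀ l, Module K (P l)] [∀ l, Module A (P l)] [∀ l, IsScalarTower K A (P l)]
    [∀ l, FiniteDimensional K (P l)] (x : A) :
    Module.finrank K (fixedSpace K (∀ l, P l) x) =
      ∑ l, Module.finrank K (fixedSpace K (P l) x) := by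
  let E : fixedSpace K (∀ l, P l) x ≃ₗ[K] ∀ l, fixedSpace K (P l) x :=
    { toFun := fun m l => ⟨m.1 l, congrFun m.2 l⟩
      invFun := fun m => ⟨fun l => (m l).1, funext fun l => (m l).2⟩
      map_add' := fun _ _ => rfl
      map_smul' := fun _ _ => rfl
      left_inv := fun _ => rfl
      right_inv := fun _ => rfl }
  rw [E.finrank_eq, Module.finrank_pi_fintype]

theorem finrank_fixedSpace_prod [FiniteDimensional K M] [FiniteDimensional K N] (x : A) :
    Module.finrank K (fixedSpace K (M × N) x) =
      Module.finrank K (fixedSpace K M x) + Module.finrank K (fixedSpace K N x) := by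
  let E : fixedSpace K (M × N) x ≃ₗ[K] fixedSpace K M x × fixedSpace K N x :=
    { toFun := fun m => (⟨m.1.1, congrArg Prod.fst m.2⟩, ⟨m.1.2, congrArg Prod.snd m.2⟩)
      invFun := fun m => ⟨(m.1.1, m.2.1), Prod.ext m.1.2 m.2.2⟩
      map_add' := fun _ _ => rfl
      map_smul' := fun _ _ => rfl
      left_inv := fun _ => rfl
      right_inv := fun _ => rfl }
  rw [E.finrank_eq, Module.finrank_prod]

theorem finrank_fixedSpace_of_equiv (f : M ≃ₗ[A] N) (x : A) :
    Module.finrank K (fixedSpace K M x) = Module.finrank K (fixedSpace K N x) := by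
  let E : fixedSpace K M x ≃ₗ[K] fixedSpace K N x :=
    { toFun := fun m => ⟨f m.1, by
        rw [mem_fixedSpace, ← map_smul, mem_fixedSpace.1 m.2]⟩
      invFun := fun m => ⟨f.symm m.1, by
        rw [mem_fixedSpace, ← map_smul, mem_fixedSpace.1 m.2]⟩
      map_add' := fun _ _ => Subtype.ext (map_add f _ _)
      map_smul' := fun c m => Subtype.ext ((f.restrictScalars K).map_smul c m.1)
      left_inv := fun m => Subtype.ext (f.symm_apply_apply m.1)
      right_inv := fun m => Subtype.ext (f.apply_symm_apply m.1) }
  exact E.finrank_eq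

end WeightSpaces

section BasicAlgebra

variable {K A V : Type} [Field K] [Ring A] [Algebra K A] [Fintype V]

/-- A complete family `e` of orthogonal idempotents of `A` together with a nilpotent ideal `r`
such that the `e k` form a basis of `A` modulo `r`. -/
structure IsBasicData (K : Type) {A V : Type} [Field K] [Ring A] [Algebra K A] [Fintype V]
    (e : V → A) (r : Submodule A A) : Prop where
  idem : ∀ k, e k * e k = e k
  orth : ∀ k l, k ≠ l → e k * e l = 0
  sum_one : ∑ k, e k = 1
  mul_mem : ∀ x ∈ r, ∀ a, x * a ∈ r
  nilpotent : ∃ m : ℕ, (r.restrictScalars K) ^ m = ⊥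
  decomp : ∀ a : A, ∃ c : V → K, a - ∑ k, c k • e k ∈ r
  not_mem : ∀ k, e k ∉ r

/-- The left ideal `A x` for an idempotent `x`. -/
def projLeft {A : Type} [Ring A] (x : A) : Submodule A A where
  carrier := {a | a * x = a}
  add_mem' {a b} ha hb := by
    simp only [Set.mem_ofPred_eq] at ha hb ⊢
    rw [add_mul, ha, hb]
  zero_mem' := zero_mul x
  smul_mem' c a ha := by
    simp only [Set.mem_ofPred_eq, smul_eq_mul] at ha ⊢
    rw [mul_assoc, ha]

@[simp] theorem mem_projLeft {x a : A} : a ∈ projLeft x ↔ a * x = a := Iff.rfl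

theorem projective_projLeft {x : A} (hx : x * x = x) : Module.Projective A (projLeft x) := by
  refine Module.Projective.of_split (M := A) (projLeft x).subtype
    ((LinearMap.toSpanSingleton A A x).codRestrict (projLeft x) fun a => ?_) ?_
  · simp [mul_assoc, hx]
  · ext a
    exact a.2

variable {e : V → A} {r : Submodule A A}

namespace IsBasicData

variable {M : Type} [AddCommGroup M] [Module K M] [Module A M] [IsScalarTower K A M]

theorem sum_smul (h : IsBasicData K e r) (m : M) : ∑ k, e k • m = m := by
  rw [← Finset.sum_smul, h.sum_one, one_smul]

theorem eq_top_of_sup_smul (h : IsBasicData K e r) (X : Submodule A M)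
    (hX : ⊤ ≤ X.restrictScalars K ⊔ r.restrictScalars K • (⊤ : Submodule K M)) : X = ⊤ := by
  have key : ∀ n : ℕ,
      ⊤ ≤ X.restrictScalars K ⊔ (r.restrictScalars K) ^ n • (⊤ : Submodule K M) := by
    intro n
    induction n with
    | zero =>
      refine le_trans (fun x _ => ?_) le_sup_right
      rw [← one_smul A x, pow_zero]
      exact Submodule.smul_mem_smul (Submodule.one_le.1 le_rfl) trivial
    | succ n ih =>
      refine hX.trans (sup_le le_sup_left ?_)
      refine (Submodule.smul_mono le_rfl ih).trans ?_
      rw [Submodule.smul_sup]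
      refine sup_le ?_ ?_
      · refine le_trans ?_ le_sup_left
        rw [Submodule.smul_le]
        intro a _ x hx
        exact X.smul_mem a hx
      · refine le_trans ?_ le_sup_right
        rw [Submodule.smul_le]
        intro a ha x hx
        refine Submodule.smul_induction_on
          (p := fun x => a • x ∈ (r.restrictScalars K) ^ (n + 1) • (⊤ : Submodule K M)) hx
          (fun b hb y hy => ?_) fun y z hy hz => ?_
        · rw [← mul_smul, pow_succ']
          exact Submodule.smul_mem_smul (Submodule.mul_mem_mul ha hb) hy
        · rw [smul_add]
          exact add_mem hy hz
  obtain ⟨m, hm⟩ := h.nilpotent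
  have := key m
  rw [hm, Submodule.bot_smul, sup_bot_eq] at this
  exact eq_top_iff.2 fun x _ => this (Submodule.mem_top (x := x))

/-- The homomorphism `⨁ A e_{κ l} → M` sending the generator of the `l`-th summand to `x l`. -/
def genMap {A V M L : Type} [Ring A] [AddCommGroup M] [Module A M] [Fintype L] (e : V → A)
    (κ : L → V) (x : L → M) : (∀ l, projLeft (e (κ l))) →ₗ[A] M where
  toFun f := ∑ l, (f l : A) • x l
  map_add' f g := by simp [add_smul, Finset.sum_add_distrib]
  map_smul' a f := by simp [mul_smul, Finset.smul_sum]

theorem genMap_apply {L : Type} [Fintype L] (κ : L → V) (x : L → M)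
    (f : ∀ l, projLeft (e (κ l))) : genMap e κ x f = ∑ l, (f l : A) • x l := rfl

/-- The generator of the `l`-th summand of `⨁ A e_{κ l}`. -/
def gen (h : IsBasicData K e r) {L : Type} [DecidableEq L] (κ : L → V) (l : L) :
    ∀ l, projLeft (e (κ l)) :=
  Pi.single l ⟨e (κ l), h.idem _⟩

theorem sum_smul_gen (h : IsBasicData K e r) {L : Type} [Fintype L] [DecidableEq L] (κ : L → V)
    (f : ∀ l, projLeft (e (κ l))) : ∑ l, (f l : A) • h.gen κ l = f := by
  ext l'
  rw [Finset.sum_apply, Finset.sum_eq_single l']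
  · rw [gen, Pi.smul_apply, Pi.single_eq_same]
    exact (f l').2
  · intro l _ hl
    simp [gen, Pi.single_eq_of_ne (Ne.symm hl)]
  · simp

theorem smul_gen (h : IsBasicData K e r) {L : Type} [DecidableEq L] (κ : L → V) (l : L) :
    e (κ l) • h.gen κ l = h.gen κ l := by
  rw [gen, ← Pi.single_smul]
  congr 1
  exact Subtype.ext (h.idem _)

theorem genMap_gen (h : IsBasicData K e r) {L : Type} [Fintype L] [DecidableEq L] (κ : L → V)
    (x : L → M) (l : L) : genMap e κ x (h.gen κ l) = e (κ l) • x l := by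
  rw [genMap_apply, Finset.sum_eq_single l]
  · simp [gen]
  · intro l' _ hl
    simp [gen, Pi.single_eq_of_ne hl]
  · simp

theorem genMap_surjective (h : IsBasicData K e r) {L : Type} [Fintype L] (κ : L → V)
    (x : L → M) (hx : ∀ l, e (κ l) • x l = x l)
    (hspan : ∀ k, ∀ m : M, e k • m = m →
      m ∈ Submodule.span K (Set.range x) ⊔ r.restrictScalars K • (⊤ : Submodule K M)) :
    Function.Surjective (genMap e κ x) := by
  classical
  rw [← LinearMap.range_eq_top]
  refine h.eq_top_of_sup_smul _ fun m _ => ?_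
  have hle : Submodule.span K (Set.range x) ≤
      (LinearMap.range (genMap e κ x)).restrictScalars K := by
    rw [Submodule.span_le]
    rintro _ ⟨l, rfl⟩
    exact ⟨h.gen κ l, by rw [h.genMap_gen, hx]⟩
  rw [← h.sum_smul (M := M) m]
  refine Submodule.sum_mem _ fun k _ => sup_le_sup_right hle _ (hspan k _ ?_)
  rw [← mul_smul, h.idem]

theorem injective_of_ker_le (h : IsBasicData K e r) {L : Type} [Fintype L] (κ : L → V)
    [Module.Projective A M] (π : (∀ l, projLeft (e (κ l))) →ₗ[A] M)
    (hs : Function.Surjective π) (hk : ∀ f, π f = 0 → ∀ l, (f l : A) ∈ r) :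
    Function.Injective π := by
  classical
  obtain ⟨s, hs⟩ := π.exists_rightInverse_of_surjective (LinearMap.range_eq_top.2 hs)
  have hs' : ∀ m, π (s m) = m := fun m => LinearMap.congr_fun hs m
  let p : (∀ l, projLeft (e (κ l))) →ₗ[A] (∀ l, projLeft (e (κ l))) :=
    LinearMap.id - s ∘ₗ π
  have hp : ∀ f, p f = f - s (π f) := fun f => rfl
  have hπp : ∀ f, π (p f) = 0 := fun f => by rw [hp, map_sub, hs', sub_self]
  have hpp : ∀ f, p (p f) = p f := fun f => by rw [hp (p f), hπp, map_zero, sub_zero]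
  have hpr : ∀ f l, (p f l : A) ∈ r := fun f l => hk _ (hπp f) l
  have hpow : ∀ n : ℕ, ∀ f l, (p f l : A) ∈ (r.restrictScalars K) ^ (n + 1) := by
    intro n
    induction n with
    | zero => intro f l; simpa using hpr f l
    | succ n ih =>
      intro f l
      rw [← hpp f, ← h.sum_smul_gen κ (p f), map_sum, Finset.sum_apply,
        AddSubmonoidClass.coe_finsetSum]
      refine Submodule.sum_mem _ fun l' _ => ?_
      rw [map_smul, pow_succ]
      exact Submodule.mul_mem_mul (ih f l') (hpr _ l)
  obtain ⟨m, hm⟩ := h.nilpotent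
  have hp0 : ∀ f, p f = 0 := by
    intro f
    ext l
    have := hpow m f l
    rw [pow_succ, hm, Submodule.bot_mul] at this
    simpa using this
  refine (injective_iff_map_eq_zero π).2 fun f hf => ?_
  have := hp0 f
  rwa [hp, hf, map_zero, sub_zero] at this

/-- An element of `A e_k` is congruent to a multiple of `e_k` modulo `r`. -/
theorem exists_smul_sub_mem (h : IsBasicData K e r) {k : V} {a : A} (ha : a * e k = a) :
    ∃ c : K, a - c • e k ∈ r := by
  obtain ⟨c, hc⟩ := h.decomp a
  refine ⟨c k, ?_⟩
  have := h.mul_mem _ hc (e k)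
  rwa [sub_mul, ha, Finset.sum_mul, Finset.sum_eq_single k, smul_mul_assoc, h.idem] at this
  · intro l _ hl
    rw [smul_mul_assoc, h.orth l k hl, smul_zero]
  · simp

theorem exists_projectiveCover (h : IsBasicData K e r) [FiniteDimensional K M] :
    ∃ (L : Type) (_ : Fintype L) (κ : L → V) (π : (∀ l, projLeft (e (κ l))) →ₗ[A] M),
      Function.Surjective π ∧ ∀ f, π f = 0 → ∀ l, (f l : A) ∈ r := by
  classical
  let R := r.restrictScalars K • (⊤ : Submodule K M)
  have hR : ∀ (a : A), ∀ m ∈ R, a • m ∈ R := by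
    intro a m hm
    refine Submodule.smul_induction_on (p := fun m => a • m ∈ R) hm (fun x hx n _ => ?_)
      fun x y hx hy => ?_
    · rw [← mul_smul]
      exact Submodule.smul_mem_smul (r.smul_mem a hx) trivial
    · rw [smul_add]
      exact add_mem hx hy
  let T := fun k => (R.comap (fixedSpace K M (e k)).subtype)
  let b := fun k => Module.finBasis K (fixedSpace K M (e k) ⧸ T k)
  let L := Σ k, Fin (Module.finrank K (fixedSpace K M (e k) ⧸ T k))
  choose y hy using fun l : L => (T l.1).mkQ_surjective (b l.1 l.2)
  let x : L → M := fun l => (y l : M)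
  have hx : ∀ l : L, e l.1 • x l = x l := fun l => (y l).2
  refine ⟨L, inferInstance, Sigma.fst, genMap e Sigma.fst x,
    h.genMap_surjective _ x hx ?_, ?_⟩
  · intro k m hm
    let m' : fixedSpace K M (e k) := ⟨m, hm⟩
    have h1 := (b k).sum_repr ((T k).mkQ m')
    let z : fixedSpace K M (e k) := ∑ i, (b k).repr ((T k).mkQ m') i • y ⟨k, i⟩
    have h2 : (T k).mkQ (m' - z) = 0 := by
      rw [map_sub, map_sum, sub_eq_zero, ← h1]
      refine Finset.sum_congr rfl fun i _ => ?_
      rw [map_smul, hy ⟨k, i⟩, h1]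
    rw [Submodule.mkQ_apply, Submodule.Quotient.mk_eq_zero] at h2
    have h3 : (z : M) ∈ Submodule.span K (Set.range x) := by
      change (fixedSpace K M (e k)).subtype z ∈ _
      rw [map_sum]
      refine Submodule.sum_mem _ fun i _ => ?_
      exact Submodule.smul_mem _ _ (Submodule.subset_span ⟨⟨k, i⟩, rfl⟩)
    rw [show m = z + (m - z) by abel]
    exact Submodule.add_mem_sup h3 h2
  · intro f hf
    choose c hc using fun l : L => h.exists_smul_sub_mem (f l).2
    have h1 : ∑ l : L, c l • x l ∈ R := by
      have h2 : ∑ l : L, ((f l : A) - c l • e l.1) • x l ∈ R :=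
        Submodule.sum_mem _ fun l _ => Submodule.smul_mem_smul (hc l) trivial
      simp_rw [sub_smul, Finset.sum_sub_distrib] at h2
      rw [genMap_apply] at hf
      rw [hf, zero_sub, Submodule.neg_mem_iff] at h2
      simpa [smul_assoc, hx] using h2
    have h3 : ∀ k i, c ⟨k, i⟩ = 0 := by
      intro k
      have h4 : ∑ i, c ⟨k, i⟩ • x ⟨k, i⟩ ∈ R := by
        have := hR (e k) _ h1
        rw [Finset.smul_sum, Fintype.sum_sigma, Finset.sum_eq_single k] at this
        · convert this using 2 with i
          rw [smul_comm, hx ⟨k, i⟩]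
        · intro l _ hl
          refine Finset.sum_eq_zero fun i _ => ?_
          rw [smul_comm, ← hx ⟨l, i⟩, ← mul_smul, h.orth _ _ hl.symm, zero_smul, smul_zero]
        · simp
      have h5 : ∑ i, c ⟨k, i⟩ • b k i = 0 := by
        have : (T k).mkQ (∑ i, c ⟨k, i⟩ • y ⟨k, i⟩) = 0 := by
          rw [Submodule.mkQ_apply, Submodule.Quotient.mk_eq_zero]
          simpa [T, x] using h4
        rw [map_sum] at this
        rw [← this]
        exact Finset.sum_congr rfl fun i _ => by rw [map_smul, hy ⟨k, i⟩]
      exact Fintype.linearIndependent_iff.1 (b k).linearIndependent _ h5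
    intro l
    have := hc l
    rwa [h3 l.1 l.2, zero_smul, sub_zero] at this

end IsBasicData

end BasicAlgebra

section PathAlgebraBasics

variable {K : Type} [Field K] {Q : FinQuiver}

theorem vertexElem_mul_self (i : Q.V) :
    vertexElem K Q i * vertexElem K Q i = vertexElem K Q i := by
  rw [vertexElem, ← map_mul]
  exact RingQuot.mkAlgHom_rel K (PathRel.idem i)

theorem vertexElem_mul_of_ne {i j : Q.V} (h : i ≠ j) :
    vertexElem K Q i * vertexElem K Q j = 0 := by
  rw [vertexElem, vertexElem, ← map_mul, RingQuot.mkAlgHom_rel K (PathRel.orth i j h), map_zero]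

theorem sum_vertexElem : ∑ i, vertexElem K Q i = 1 := by
  simp only [vertexElem]
  rw [← map_sum, RingQuot.mkAlgHom_rel K (PathRel.sum_one), map_one]

theorem vertexElem_tgt_mul_arrowElem (a : Q.A) :
    vertexElem K Q (Q.tgt a) * arrowElem K Q a = arrowElem K Q a := by
  rw [vertexElem, arrowElem, ← map_mul]
  exact RingQuot.mkAlgHom_rel K (PathRel.tgt_mul a)

theorem arrowElem_mul_vertexElem_src (a : Q.A) :
    arrowElem K Q a * vertexElem K Q (Q.src a) = arrowElem K Q a := by
  rw [vertexElem, arrowElem, ← map_mul]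
  exact RingQuot.mkAlgHom_rel K (PathRel.mul_src a)

namespace PathAlgebra

theorem induction {P : PathAlgebra K Q → Prop} (one : P 1) (vertex : ∀ i, P (vertexElem K Q i))
    (arrow : ∀ a, P (arrowElem K Q a)) (add : ∀ x y, P x → P y → P (x + y))
    (mul : ∀ x y, P x → P y → P (x * y)) (smul : ∀ (c : K) x, P x → P (c • x))
    (x : PathAlgebra K Q) : P x := by
  obtain ⟨y, rfl⟩ := RingQuot.mkAlgHom_surjective K (PathRel K Q) x
  induction y with
  | grade0 c =>
    rw [AlgHom.commutes, Algebra.algebraMap_eq_smul_one]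
    exact smul c 1 one
  | grade1 z =>
    cases z with
    | inl i => exact vertex i
    | inr a => exact arrow a
  | mul x y hx hy => rw [map_mul]; exact mul _ _ hx hy
  | add x y hx hy => rw [map_add]; exact add _ _ hx hy

variable {C : Type} [Ring C] [Algebra K C]

/-- The algebra homomorphism `KQ → C` with prescribed values on vertices and arrows. -/
def lift (E : Q.V → C) (F : Q.A → C) (idem : ∀ i, E i * E i = E i)
    (orth : ∀ i j, i ≠ j → E i * E j = 0) (sum_one : ∑ i, E i = 1)
    (tgt_mul : ∀ a, E (Q.tgt a) * F a = F a) (mul_src : ∀ a, F a * E (Q.src a) = F a) :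
    PathAlgebra K Q →ₐ[K] C :=
  RingQuot.liftAlgHom K ⟨FreeAlgebra.lift K (Sum.elim E F), by
    intro x y hxy
    cases hxy with
    | idem i => simpa using idem i
    | orth i j h => simpa using orth i j h
    | sum_one => simpa using sum_one
    | tgt_mul a => simpa using tgt_mul a
    | mul_src a => simpa using mul_src a⟩

section

variable (E : Q.V → C) (F : Q.A → C) (idem : ∀ i, E i * E i = E i)
    (orth : ∀ i j, i ≠ j → E i * E j = 0) (sum_one : ∑ i, E i = 1)
    (tgt_mul : ∀ a, E (Q.tgt a) * F a = F a) (mul_src : ∀ a, F a * E (Q.src a) = F a)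

@[simp] theorem lift_vertexElem (i : Q.V) :
    lift (K := K) E F idem orth sum_one tgt_mul mul_src (vertexElem K Q i) = E i := by
  simp [lift, vertexElem]

@[simp] theorem lift_arrowElem (a : Q.A) :
    lift (K := K) E F idem orth sum_one tgt_mul mul_src (arrowElem K Q a) = F a := by
  simp [lift, arrowElem]

end

theorem algHom_eq {f g : PathAlgebra K Q →ₐ[K] C}
    (hv : ∀ i, f (vertexElem K Q i) = g (vertexElem K Q i))
    (ha : ∀ a, f (arrowElem K Q a) = g (arrowElem K Q a)) (x : PathAlgebra K Q) : f x = g x := by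
  refine induction (P := fun x => f x = g x) ?_ hv ha ?_ ?_ ?_ x
  · rw [map_one, map_one]
  · intro x y hx hy; rw [map_add, map_add, hx, hy]
  · intro x y hx hy; rw [map_mul, map_mul, hx, hy]
  · intro c x hx; rw [map_smul, map_smul, hx]

end PathAlgebra

theorem vertexElem_tgt_mul_pathElem (p : QPath Q) :
    vertexElem K Q p.tgt * pathElem K Q p = pathElem K Q p := by
  obtain ⟨l, hne, hl⟩ := p
  cases l with
  | nil => exact absurd rfl hne
  | cons a l =>
    simp only [pathElem, QPath.tgt, List.head_cons, List.map_cons, List.prod_cons]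
    rw [← mul_assoc, vertexElem_tgt_mul_arrowElem]

theorem arrowElem_mul_pathElem (a : Q.A) (p : QPath Q) :
    arrowElem K Q a * pathElem K Q p = 0 ∨
      ∃ q : QPath Q, q.length = p.length + 1 ∧
        pathElem K Q q = arrowElem K Q a * pathElem K Q p := by
  by_cases h : Q.src a = p.tgt
  · right
    refine ⟨⟨a :: p.arrows, List.cons_ne_nil _ _, ?_⟩, rfl, ?_⟩
    · have := p.chain
      refine List.IsChain.cons this ?_
      intro b hb
      rw [h, QPath.tgt]
      congr 1
      rw [List.head?_eq_some_head p.ne] at hb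
      exact (Option.mem_some_iff.1 hb)
    · simp [pathElem]
  · left
    rw [← vertexElem_tgt_mul_pathElem, ← arrowElem_mul_vertexElem_src, mul_assoc,
      ← mul_assoc (vertexElem K Q _), vertexElem_mul_of_ne h, zero_mul, mul_zero]

variable (K Q) in
/-- The span of the arrows in the path algebra. -/
def arrowSpan : Submodule K (PathAlgebra K Q) := Submodule.span K (Set.range (arrowElem K Q))

variable (K Q) in
/-- The ideal of the path algebra generated by the arrows. -/
def pathRadical : Submodule K (PathAlgebra K Q) := ⊤ * arrowSpan K Q

theorem arrowElem_mem_arrowSpan (a : Q.A) : arrowElem K Q a ∈ arrowSpan K Q :=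
  Submodule.subset_span ⟨a, rfl⟩

theorem arrowSpan_le_pathRadical : arrowSpan K Q ≤ pathRadical K Q := by
  intro x hx
  rw [← one_mul x]
  exact Submodule.mul_mem_mul trivial hx

theorem mul_mem_pathRadical_left (x : PathAlgebra K Q) {y : PathAlgebra K Q}
    (hy : y ∈ pathRadical K Q) : x * y ∈ pathRadical K Q := by
  have h : (⊤ : Submodule K (PathAlgebra K Q)) * (⊤ * arrowSpan K Q) ≤ ⊤ * arrowSpan K Q := by
    rw [← mul_assoc]
    exact mul_le_mul_left le_top _
  exact h (Submodule.mul_mem_mul trivial hy)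

theorem mul_vertexElem_mem_arrowSpan {w : PathAlgebra K Q} (hw : w ∈ arrowSpan K Q) (k : Q.V) :
    w * vertexElem K Q k ∈ arrowSpan K Q := by
  refine Submodule.span_induction (p := fun w _ => w * vertexElem K Q k ∈ arrowSpan K Q)
    ?_ ?_ ?_ ?_ hw
  · rintro _ ⟨a, rfl⟩
    by_cases h : Q.src a = k
    · rw [← h, arrowElem_mul_vertexElem_src]
      exact arrowElem_mem_arrowSpan a
    · rw [← arrowElem_mul_vertexElem_src, mul_assoc, vertexElem_mul_of_ne h, mul_zero]
      exact zero_mem _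
  · rw [zero_mul]; exact zero_mem _
  · intro x y _ _ hx hy; rw [add_mul]; exact add_mem hx hy
  · intro c x _ hx; rw [smul_mul_assoc]; exact Submodule.smul_mem _ _ hx

theorem mul_mem_pathRadical_right {y : PathAlgebra K Q} (hy : y ∈ pathRadical K Q)
    (x : PathAlgebra K Q) : y * x ∈ pathRadical K Q := by
  refine PathAlgebra.induction (P := fun x => ∀ y ∈ pathRadical K Q, y * x ∈ pathRadical K Q)
    ?_ ?_ ?_ ?_ ?_ ?_ x y hy
  · intro y hy; rwa [mul_one]
  · intro k y hy
    refine Submodule.mul_induction_on hy (fun p _ w hw => ?_) fun a b ha hb => ?_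
    · rw [mul_assoc]
      exact Submodule.mul_mem_mul trivial (mul_vertexElem_mem_arrowSpan hw k)
    · rw [add_mul]; exact add_mem ha hb
  · intro a y _
    exact Submodule.mul_mem_mul trivial (arrowElem_mem_arrowSpan a)
  · intro a b ha hb y hy; rw [mul_add]; exact add_mem (ha y hy) (hb y hy)
  · intro a b ha hb y hy; rw [← mul_assoc]; exact hb _ (ha y hy)
  · intro c a ha y hy; rw [mul_smul_comm]; exact Submodule.smul_mem _ _ (ha y hy)

theorem sum_smul_vertexElem_mul (c c' : Q.V → K) :
    (∑ k, c k • vertexElem K Q k) * (∑ k, c' k • vertexElem K Q k) =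
      ∑ k, (c k * c' k) • vertexElem K Q k := by
  rw [Finset.sum_mul]
  refine Finset.sum_congr rfl fun k _ => ?_
  rw [Finset.mul_sum, Finset.sum_eq_single k]
  · rw [smul_mul_smul_comm, vertexElem_mul_self]
  · intro l _ hl
    rw [smul_mul_smul_comm, vertexElem_mul_of_ne hl.symm, smul_zero]
  · simp

theorem exists_sub_mem_pathRadical (x : PathAlgebra K Q) :
    ∃ c : Q.V → K, x - ∑ k, c k • vertexElem K Q k ∈ pathRadical K Q := by
  refine PathAlgebra.induction (P := fun x => ∃ c : Q.V → K,
    x - ∑ k, c k • vertexElem K Q k ∈ pathRadical K Q) ?_ ?_ ?_ ?_ ?_ ?_ x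
  · exact ⟨fun _ => 1, by simp [sum_vertexElem]⟩
  · exact fun i => ⟨Pi.single i 1, by simp [Pi.single_apply]⟩
  · exact fun a => ⟨0, by simpa using arrowSpan_le_pathRadical (arrowElem_mem_arrowSpan a)⟩
  · rintro x y ⟨c, hc⟩ ⟨c', hc'⟩
    refine ⟨c + c', ?_⟩
    have := add_mem hc hc'
    simp only [Pi.add_apply, add_smul, Finset.sum_add_distrib]
    rwa [add_sub_add_comm]
  · rintro x y ⟨c, hc⟩ ⟨c', hc'⟩
    refine ⟨fun k => c k * c' k, ?_⟩
    rw [← sum_smul_vertexElem_mul]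
    have := add_mem (mul_mem_pathRadical_right hc y) (mul_mem_pathRadical_left
      (∑ k, c k • vertexElem K Q k) hc')
    rwa [sub_mul, mul_sub, sub_add_sub_cancel] at this
  · rintro a x ⟨c, hc⟩
    refine ⟨a • c, ?_⟩
    have := Submodule.smul_mem _ a hc
    simpa [smul_sub, Finset.smul_sum, smul_smul] using this

/-- The coefficient of the vertex `k` in an element of the path algebra. -/
def vertexCoeff (k : Q.V) : PathAlgebra K Q →ₐ[K] K :=
  PathAlgebra.lift (fun i => if i = k then 1 else 0) (fun _ => 0)
    (by intro i; split_ifs <;> simp)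
    (by
      intro i j h
      by_cases hi : i = k
      · rw [if_neg fun hj : j = k => h (hi.trans hj.symm), mul_zero]
      · simp [hi])
    (by simp) (by simp) (by simp)

theorem vertexCoeff_eq_zero {y : PathAlgebra K Q} (hy : y ∈ pathRadical K Q) (k : Q.V) :
    vertexCoeff k y = 0 := by
  refine Submodule.mul_induction_on hy (fun p _ w hw => ?_) fun a b ha hb => ?_
  · rw [map_mul]
    have : vertexCoeff k w = 0 := by
      refine Submodule.span_induction (p := fun w _ => vertexCoeff k w = 0) ?_ ?_ ?_ ?_ hw
      · rintro _ ⟨a, rfl⟩; simp [vertexCoeff]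
      · exact map_zero _
      · intro x y _ _ hx hy; rw [map_add, hx, hy, add_zero]
      · intro c x _ hx; rw [map_smul, hx, smul_zero]
    rw [this, mul_zero]
  · rw [map_add, ha, hb, add_zero]

theorem pathRadical_pow_le (m : ℕ) : pathRadical K Q ^ m ≤ ⊤ * arrowSpan K Q ^ m := by
  induction m with
  | zero => rw [pow_zero, pow_zero, mul_one]; exact le_top
  | succ m ih =>
    calc pathRadical K Q ^ (m + 1) ≤ pathRadical K Q * (⊤ * arrowSpan K Q ^ m) := by
          rw [pow_succ']; exact mul_le_mul' le_rfl ih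
      _ = pathRadical K Q * ⊤ * arrowSpan K Q ^ m := (mul_assoc _ _ _).symm
      _ ≤ pathRadical K Q * arrowSpan K Q ^ m := by
          refine mul_le_mul' (Submodule.mul_le.2 fun y hy x _ => ?_) le_rfl
          exact mul_mem_pathRadical_right hy x
      _ = ⊤ * arrowSpan K Q ^ (m + 1) := by rw [pathRadical, mul_assoc, ← pow_succ']

theorem arrowSpan_pow_le (m : ℕ) : arrowSpan K Q ^ (m + 1) ≤
    Submodule.span K {x | ∃ p : QPath Q, p.length = m + 1 ∧ pathElem K Q p = x} := by
  induction m with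
  | zero =>
    rw [zero_add, pow_one, arrowSpan, Submodule.span_le]
    rintro _ ⟨a, rfl⟩
    exact Submodule.subset_span ⟨⟨[a], by simp, List.isChain_singleton a⟩, rfl, by simp [pathElem]⟩
  | succ m ih =>
    rw [pow_succ']
    refine (mul_le_mul' le_rfl ih).trans ?_
    rw [arrowSpan, Submodule.span_mul_span, Submodule.span_le]
    rintro _ ⟨_, ⟨a, rfl⟩, _, ⟨p, hp, rfl⟩, rfl⟩
    rcases arrowElem_mul_pathElem (K := K) a p with h | ⟨q, hq, h⟩
    · simp only [h]
      exact zero_mem _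
    · exact Submodule.subset_span ⟨q, by rw [hq, hp], h⟩

section Presentation

variable {A : Type} [Ring A] [Algebra K A] {φ : PathAlgebra K Q →ₐ[K] A}

/-- The left ideal generated by the images of the arrows. -/
def arrowIdeal (φ : PathAlgebra K Q →ₐ[K] A) (hφ : Function.Surjective φ) : Submodule A A where
  carrier := (pathRadical K Q).map φ.toLinearMap
  add_mem' := add_mem
  zero_mem' := zero_mem _
  smul_mem' := by
    rintro a _ ⟨y, hy, rfl⟩
    obtain ⟨x, rfl⟩ := hφ a
    exact ⟨x * y, mul_mem_pathRadical_left x hy, map_mul φ x y⟩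

/-- A homomorphism killing all relations in the kernel of `φ` kills the kernel of `φ`. -/
theorem IsAdmissiblePresentation.map_eq_zero (h : IsAdmissiblePresentation K Q φ)
    {C : Type} [Ring C] [Algebra K C] (ψ : PathAlgebra K Q →ₐ[K] C)
    (hψ : ∀ c i j, IsRelationData K Q c i j → φ (relElem K Q c) = 0 → ψ (relElem K Q c) = 0)
    {x : PathAlgebra K Q} (hx : φ x = 0) : ψ x = 0 := by
  obtain ⟨-, ⟨S, hS, hker⟩, -⟩ := h
  have hx' : x ∈ AddSubgroup.closure {x | ∃ a b : PathAlgebra K Q, ∃ s ∈ S, x = a * s * b} := by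
    have : x ∈ twoSidedSpan (PathAlgebra K Q) S := by rw [hker]; exact hx
    exact this
  have hle : AddSubgroup.closure {x | ∃ a b : PathAlgebra K Q, ∃ s ∈ S, x = a * s * b} ≤
      ψ.toRingHom.toAddMonoidHom.ker := by
    rw [AddSubgroup.closure_le]
    rintro _ ⟨a, b, s, hs, rfl⟩
    have h0 : φ s = 0 := by
      have : s ∈ twoSidedSpan (PathAlgebra K Q) S :=
        AddSubgroup.subset_closure ⟨1, 1, s, hs, by simp⟩
      rw [hker] at this
      exact this
    obtain ⟨c, i, j, hc, rfl⟩ := hS s hs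
    change ψ (a * relElem K Q c * b) = 0
    rw [map_mul, map_mul, hψ c i j hc h0, mul_zero, zero_mul]
  exact hle hx'

theorem IsAdmissiblePresentation.map_eq_zero_of_arrow_mul_arrow
    (h : IsAdmissiblePresentation K Q φ) {C : Type} [Ring C] [Algebra K C]
    (ψ : PathAlgebra K Q →ₐ[K] C)
    (hψ : ∀ a b, ψ (arrowElem K Q a) * ψ (arrowElem K Q b) = 0)
    {x : PathAlgebra K Q} (hx : φ x = 0) : ψ x = 0 := by
  refine h.map_eq_zero ψ (fun c i j hc _ => ?_) hx
  rw [relElem, Finsupp.sum, map_sum]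
  refine Finset.sum_eq_zero fun p hp => ?_
  obtain ⟨h2, -, -⟩ := hc p hp
  obtain ⟨l, hne, hl⟩ := p
  rcases l with _ | ⟨a, _ | ⟨b, l⟩⟩
  · exact absurd rfl hne
  · simp [QPath.length] at h2
  · simp only [pathElem, List.map_cons, List.prod_cons, map_smul, map_mul]
    rw [← mul_assoc, hψ, zero_mul, smul_zero]

theorem IsAdmissiblePresentation.isBasicData (h : IsAdmissiblePresentation K Q φ) :
    IsBasicData K (fun k => φ (vertexElem K Q k)) (arrowIdeal φ h.1) where
  idem k := by rw [← map_mul, vertexElem_mul_self]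
  orth k l hkl := by rw [← map_mul, vertexElem_mul_of_ne hkl, map_zero]
  sum_one := by rw [← map_sum, sum_vertexElem, map_one]
  mul_mem := by
    rintro _ ⟨y, hy, rfl⟩ a
    obtain ⟨x, rfl⟩ := h.1 a
    exact ⟨y * x, mul_mem_pathRadical_right hy x, map_mul φ y x⟩
  nilpotent := by
    obtain ⟨m, hm, hp⟩ := h.2.2
    refine ⟨m, ?_⟩
    have h1 : (arrowIdeal φ h.1).restrictScalars K = (pathRadical K Q).map φ.toLinearMap := rfl
    rw [h1, ← Submodule.map_pow, eq_bot_iff]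
    refine (Submodule.map_mono (pathRadical_pow_le m)).trans ?_
    obtain ⟨m, rfl⟩ : ∃ n, m = n + 1 := ⟨m - 1, by omega⟩
    rw [Submodule.map_mul]
    refine (mul_le_mul' le_rfl (Submodule.map_mono (arrowSpan_pow_le m))).trans ?_
    have h2 : (Submodule.span K {x | ∃ p : QPath Q, p.length = m + 1 ∧ pathElem K Q p = x}).map
        φ.toLinearMap = ⊥ := by
      rw [Submodule.map_span, Submodule.span_eq_bot]
      rintro _ ⟨_, ⟨p, hpm, rfl⟩, rfl⟩
      exact hp p hpm.ge
    rw [h2, Submodule.mul_bot]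
  decomp a := by
    obtain ⟨x, rfl⟩ := h.1 a
    obtain ⟨c, hc⟩ := exists_sub_mem_pathRadical x
    refine ⟨c, _, hc, ?_⟩
    simp [map_sub, map_sum, map_smul]
  not_mem := by
    rintro k ⟨y, hy, hyk⟩
    have h0 : φ (vertexElem K Q k - y) = 0 := by
      rw [map_sub, sub_eq_zero]; exact hyk.symm
    have h1 := h.map_eq_zero_of_arrow_mul_arrow (vertexCoeff k)
      (fun a b => by simp [vertexCoeff]) h0
    rw [map_sub, vertexCoeff_eq_zero hy] at h1
    simp [vertexCoeff] at h1

end Presentation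

end PathAlgebraBasics

section HereditaryToFree

variable {K : Type} [Field K] {Q : FinQuiver}
variable {A : Type} [Ring A] [Algebra K A] {φ : PathAlgebra K Q →ₐ[K] A}

theorem exists_eq_sum_mul_arrowElem {x : PathAlgebra K Q} (hx : x ∈ pathRadical K Q) :
    ∃ F : Q.A → PathAlgebra K Q, (∀ a, F a * vertexElem K Q (Q.tgt a) = F a) ∧
      x = ∑ a, F a * arrowElem K Q a := by
  refine Submodule.mul_induction_on hx (fun p _ w hw => ?_) ?_
  · obtain ⟨c, rfl⟩ := (Submodule.mem_span_range_iff_exists_fun K).1 hw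
    refine ⟨fun a => (c a • p) * vertexElem K Q (Q.tgt a), fun a => ?_, ?_⟩
    · rw [mul_assoc, vertexElem_mul_self]
    · rw [Finset.mul_sum]
      refine Finset.sum_congr rfl fun a _ => ?_
      rw [mul_assoc, vertexElem_tgt_mul_arrowElem, mul_smul_comm, smul_mul_assoc]
  · rintro x y ⟨F, hF, rfl⟩ ⟨G, hG, rfl⟩
    refine ⟨F + G, fun a => ?_, ?_⟩
    · rw [Pi.add_apply, add_mul, hF, hG]
    · simp [add_mul, Finset.sum_add_distrib]

theorem mem_pathRadical_of_map_eq_zero (h : IsAdmissiblePresentation K Q φ)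
    {x : PathAlgebra K Q} (hx : φ x = 0) : x ∈ pathRadical K Q := by
  obtain ⟨c, hc⟩ := exists_sub_mem_pathRadical x
  have h0 : ∀ k, c k = 0 := by
    intro k
    have h1 := vertexCoeff_eq_zero hc k
    rw [map_sub, h.map_eq_zero_of_arrow_mul_arrow (vertexCoeff k)
      (fun a b => by simp [vertexCoeff]) hx] at h1
    simpa [vertexCoeff] using h1
  simpa [h0] using hc

/-- The two-dimensional representation with the arrow `a` acting nontrivially. -/
def arrowRep (a : Q.A) : PathAlgebra K Q →ₐ[K] Matrix (Fin 2) (Fin 2) K :=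
  PathAlgebra.lift
    (fun i => !![if i = Q.tgt a then 1 else 0, 0; 0, if i = Q.src a then 1 else 0])
    (fun b => if b = a then !![0, 1; 0, 0] else 0)
    (by
      intro i
      ext u v
      fin_cases u <;> fin_cases v <;> simp [Matrix.mul_apply, Fin.sum_univ_two])
    (by
      intro i j hij
      ext u v
      fin_cases u <;> fin_cases v <;> simp [Matrix.mul_apply, Fin.sum_univ_two] <;>
        (intro h1 h2; exact hij (h2.trans h1.symm)))
    (by
      ext u v
      fin_cases u <;> fin_cases v <;> simp [Matrix.sum_apply])
    (by
      intro b
      by_cases h : b = a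
      · ext u v
        fin_cases u <;> fin_cases v <;> simp [Matrix.mul_apply, Fin.sum_univ_two, h]
      · simp [h])
    (by
      intro b
      by_cases h : b = a
      · ext u v
        fin_cases u <;> fin_cases v <;> simp [Matrix.mul_apply, Fin.sum_univ_two, h]
      · simp [h])

theorem arrowRep_arrowElem_mul (a b b' : Q.A) :
    arrowRep (K := K) a (arrowElem K Q b) * arrowRep a (arrowElem K Q b') = 0 := by
  simp only [arrowRep, PathAlgebra.lift_arrowElem]
  ext u v
  split_ifs <;> fin_cases u <;> fin_cases v <;> simp [Matrix.mul_apply, Fin.sum_univ_two]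

theorem arrowRep_apply_zero {x : PathAlgebra K Q} (hx : x ∈ pathRadical K Q) (a : Q.A) :
    arrowRep a x 0 0 = 0 := by
  refine Submodule.mul_induction_on hx (fun p _ w hw => ?_) fun x y hx hy => ?_
  · obtain ⟨c, rfl⟩ := (Submodule.mem_span_range_iff_exists_fun K).1 hw
    have : ∀ b, (arrowRep a (arrowElem K Q b)) 0 0 = 0 ∧ (arrowRep a (arrowElem K Q b)) 1 0 = 0 := by
      intro b
      simp only [arrowRep, PathAlgebra.lift_arrowElem]
      split_ifs <;> simp
    rw [map_mul, map_sum, Matrix.mul_apply]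
    simp [Matrix.sum_apply, this]
  · rw [map_add, Matrix.add_apply, hx, hy, add_zero]

theorem projective_arrowIdeal (h : IsAdmissiblePresentation K Q φ) (hA : IsHereditaryRing A) :
    Module.Projective A (arrowIdeal φ h.1) := by
  have h1 : ProjDimLT A (A ⧸ arrowIdeal φ h.1) 2 := (hA (ModuleCat.of A (A ⧸ arrowIdeal φ h.1))).projDimLT
  have h2 : ProjDimLT A A 1 := projDimLT_of_projective 0
  have h3 := projDimLT_ker (f := (arrowIdeal φ h.1).mkQ) (Submodule.mkQ_surjective _) h2 h1
  rw [Submodule.ker_mkQ] at h3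
  exact projDimLT_one_iff.1 h3

theorem map_eq_zero_of_map_sum_eq_zero (h : IsAdmissiblePresentation K Q φ)
    (hA : IsHereditaryRing A) (F : Q.A → PathAlgebra K Q)
    (hF : ∀ a, F a * vertexElem K Q (Q.tgt a) = F a)
    (hφ : φ (∑ a, F a * arrowElem K Q a) = 0) (a : Q.A) : φ (F a) = 0 := by
  let r := arrowIdeal φ h.1
  let e := fun k => φ (vertexElem K Q k)
  have hb : IsBasicData K e r := h.isBasicData
  have := projective_arrowIdeal h hA
  let x : Q.A → r := fun a =>
    ⟨φ (arrowElem K Q a), _, arrowSpan_le_pathRadical (arrowElem_mem_arrowSpan a), rfl⟩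
  have hx : ∀ a, (x a : A) = φ (arrowElem K Q a) := fun _ => rfl
  have hπ : ∀ f, (IsBasicData.genMap e Q.tgt x f : A) = ∑ a, (f a : A) * φ (arrowElem K Q a) := by
    intro f
    rw [IsBasicData.genMap_apply, AddSubmonoidClass.coe_finsetSum]
    rfl
  have hsurj : Function.Surjective (IsBasicData.genMap e Q.tgt x) := by
    rintro ⟨_, y, hy, rfl⟩
    obtain ⟨G, hG, rfl⟩ := exists_eq_sum_mul_arrowElem hy
    refine ⟨fun a => ⟨φ (G a), ?_⟩, Subtype.ext ?_⟩
    · rw [mem_projLeft, ← map_mul, hG]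
    · rw [hπ]
      simp
  have hker : ∀ f, IsBasicData.genMap e Q.tgt x f = 0 → ∀ a, (f a : A) ∈ r := by
    intro f hf a
    have hf' : ∑ a, (f a : A) * φ (arrowElem K Q a) = 0 := by rw [← hπ, hf]; rfl
    choose c y hy hyc using fun a => hb.exists_smul_sub_mem (f a).2
    have hfa : ∀ a, (f a : A) = φ (c a • vertexElem K Q (Q.tgt a) + y a) := by
      intro a
      have : φ (y a) = f a - c a • e (Q.tgt a) := hyc a
      rw [map_add, map_smul, this, add_sub_cancel]
    have h0 : φ (∑ a, (c a • vertexElem K Q (Q.tgt a) + y a) * arrowElem K Q a) = 0 := by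
      rw [← hf', map_sum]
      exact Finset.sum_congr rfl fun a _ => by rw [map_mul, hfa]
    have h1 := h.map_eq_zero_of_arrow_mul_arrow (arrowRep a) (arrowRep_arrowElem_mul a) h0
    have h2 := congrFun (congrFun h1 0) 1
    rw [map_sum, Finset.sum_eq_single a, map_mul, Matrix.mul_apply, map_add, map_smul] at h2
    · have hca : c a = 0 := by
        have h3 : arrowRep (K := K) a (arrowElem K Q a) = !![0, 1; 0, 0] := by simp [arrowRep]
        have h4 : arrowRep (K := K) a (vertexElem K Q (Q.tgt a)) 0 0 = 1 := by simp [arrowRep]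
        rw [h3] at h2
        simpa [arrowRep_apply_zero (hy a), h4] using h2
      have := hfa a
      rw [hca, zero_smul, zero_add] at this
      rw [this]
      exact ⟨y a, hy a, rfl⟩
    · intro b _ hb
      rw [map_mul]
      simp [arrowRep, hb]
    · simp
  have hinj := hb.injective_of_ker_le Q.tgt _ hsurj hker
  let f : ∀ a, projLeft (e (Q.tgt a)) := fun a => ⟨φ (F a), by
    rw [mem_projLeft, ← map_mul, hF]⟩
  have hf : IsBasicData.genMap e Q.tgt x f = 0 := by
    apply Subtype.ext
    rw [hπ, Submodule.coe_zero, ← hφ, map_sum]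
    exact Finset.sum_congr rfl fun a _ => by rw [map_mul]
  have := (injective_iff_map_eq_zero _).1 hinj f hf
  exact congrArg Subtype.val (congrFun this a)

open Polynomial in
/-- The path length grading of the path algebra. -/
def lengthGrading : PathAlgebra K Q →ₐ[K] (PathAlgebra K Q)[X] :=
  PathAlgebra.lift (fun i => C (vertexElem K Q i)) (fun a => C (arrowElem K Q a) * X)
    (fun i => by rw [← C_mul, vertexElem_mul_self])
    (fun i j h => by rw [← C_mul, vertexElem_mul_of_ne h, C_0])
    (by rw [← map_sum, sum_vertexElem, C_1])
    (fun a => by rw [← mul_assoc, ← C_mul, vertexElem_tgt_mul_arrowElem])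
    (fun a => by rw [mul_assoc, X_mul_C, ← mul_assoc, ← C_mul, arrowElem_mul_vertexElem_src])

theorem eval_one_lengthGrading (x : PathAlgebra K Q) : (lengthGrading x).eval 1 = x := by
  refine PathAlgebra.induction (P := fun x => (lengthGrading x).eval 1 = x) ?_ ?_ ?_ ?_ ?_ ?_ x
  · simp
  · intro i; simp [lengthGrading]
  · intro a; simp [lengthGrading]
  · intro x y hx hy; rw [map_add, Polynomial.eval_add, hx, hy]
  · intro x y hx hy
    have := map_mul (Polynomial.eval₂RingHom' (RingHom.id (PathAlgebra K Q)) 1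
      fun _ => Commute.one_right _) (lengthGrading x) (lengthGrading y)
    change (lengthGrading x * lengthGrading y).eval 1 =
      (lengthGrading x).eval 1 * (lengthGrading y).eval 1 at this
    rw [map_mul, this, hx, hy]
  · intro c x hx; rw [map_smul, Polynomial.eval_smul, hx]

theorem injective_of_isHereditaryRing (h : IsAdmissiblePresentation K Q φ)
    (hA : IsHereditaryRing A) {x : PathAlgebra K Q} (hx : φ x = 0) : x = 0 := by
  have key : ∀ n x, φ x = 0 → (lengthGrading x).coeff n = 0 := by
    intro n
    induction n with
    | zero =>
      intro x hx
      obtain ⟨F, hF, rfl⟩ := exists_eq_sum_mul_arrowElem (mem_pathRadical_of_map_eq_zero h hx)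
      simp [lengthGrading, ← mul_assoc]
    | succ n ih =>
      intro x hx
      obtain ⟨F, hF, rfl⟩ := exists_eq_sum_mul_arrowElem (mem_pathRadical_of_map_eq_zero h hx)
      rw [map_sum, Polynomial.finsetSum_coeff]
      refine Finset.sum_eq_zero fun a _ => ?_
      have h1 := ih (F a) (map_eq_zero_of_map_sum_eq_zero h hA F hF hx a)
      have h2 : lengthGrading (arrowElem K Q a) = Polynomial.C (arrowElem K Q a) * .X := by
        simp [lengthGrading]
      rw [map_mul, h2, ← mul_assoc, Polynomial.coeff_mul_X, Polynomial.coeff_mul_C, h1, zero_mul]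
  have h0 : lengthGrading x = 0 := Polynomial.ext fun n => key n x hx
  rw [← eval_one_lengthGrading x, h0, Polynomial.eval_zero]

end HereditaryToFree

section MatrixRepresentations

variable {K : Type} [Field K] {Q : FinQuiver}

/-- The block of the matrix `X` belonging to the arrow `a`. -/
def arrowBlock {R : Type} [Zero R] (d : Q.V → ℕ) (a : Q.A)
    (X : Matrix (RepIx Q d) (RepIx Q d) R) : Matrix (RepIx Q d) (RepIx Q d) R :=
  Matrix.of fun u v => if u.1 = Q.tgt a ∧ v.1 = Q.src a then X u v else 0

/-- The representation of the path algebra given by a tuple of block matrices. -/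
def matrixRep {R : Type} [CommRing R] [Algebra K R] (d : Q.V → ℕ)
    (X : Q.A → Matrix (RepIx Q d) (RepIx Q d) R) :
    PathAlgebra K Q →ₐ[K] Matrix (RepIx Q d) (RepIx Q d) R :=
  PathAlgebra.lift (fun i => Matrix.diagonal fun u => if u.1 = i then 1 else 0)
    (fun a => arrowBlock d a (X a))
    (fun i => by
      rw [Matrix.diagonal_mul_diagonal]
      congr 1
      funext u
      split_ifs <;> simp)
    (fun i j h => by
      rw [Matrix.diagonal_mul_diagonal, ← Matrix.diagonal_zero]
      congr 1
      funext u
      by_cases hu : u.1 = i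
      · rw [if_neg fun hj : u.1 = j => h (hu.symm.trans hj), mul_zero]
      · rw [if_neg hu, zero_mul])
    (by
      ext u v
      rw [Matrix.sum_apply]
      by_cases h : u = v
      · subst h; simp
      · simp [h])
    (fun a => by
      ext u v
      by_cases h : u.1 = Q.tgt a <;> simp [Matrix.diagonal_mul, arrowBlock, h])
    (fun a => by
      ext u v
      by_cases h : v.1 = Q.src a <;> simp [Matrix.mul_diagonal, arrowBlock, h])

section

variable {R R' : Type} [CommRing R] [Algebra K R] [CommRing R'] [Algebra K R'] (d : Q.V → ℕ)

theorem matrixRep_vertexElem (X : Q.A → Matrix (RepIx Q d) (RepIx Q d) R) (i : Q.V) :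
    matrixRep (K := K) d X (vertexElem K Q i) =
      Matrix.diagonal fun u => if u.1 = i then 1 else 0 := by
  simp [matrixRep]

theorem matrixRep_arrowElem (X : Q.A → Matrix (RepIx Q d) (RepIx Q d) R) (a : Q.A) :
    matrixRep (K := K) d X (arrowElem K Q a) = arrowBlock d a (X a) := by
  simp [matrixRep]

theorem matrixRep_map (f : R →ₐ[K] R') (X : Q.A → Matrix (RepIx Q d) (RepIx Q d) R)
    (x : PathAlgebra K Q) :
    (matrixRep d X x).map f = matrixRep d (fun a => (X a).map f) x := by
  refine PathAlgebra.algHom_eq (f := f.mapMatrix.comp (matrixRep d X))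
    (g := matrixRep d (fun a => (X a).map f)) (fun i => ?_) (fun a => ?_) x
  · rw [AlgHom.comp_apply, matrixRep_vertexElem, matrixRep_vertexElem, AlgHom.mapMatrix_apply,
      Matrix.diagonal_map (map_zero f)]
    congr 1
    funext u
    simp [apply_ite f]
  · rw [AlgHom.comp_apply, matrixRep_arrowElem, matrixRep_arrowElem, AlgHom.mapMatrix_apply]
    ext u v
    simp [arrowBlock, apply_ite f]

theorem arrowBlock_eq_of_blockCompatible {M : RepSpace K Q d} (hM : BlockCompatible K Q d M)
    (a : Q.A) : arrowBlock d a (M a) = M a := by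
  ext u v
  simp only [arrowBlock, Matrix.of_apply, ite_eq_left_iff]
  intro h
  by_contra h0
  exact h (hM a u v (Ne.symm h0))

theorem matrixRep_pathElem {M : RepSpace K Q d} (hM : BlockCompatible K Q d M) (p : QPath Q) :
    matrixRep d M (pathElem K Q p) = pathProd K Q d M p := by
  rw [pathElem, map_list_prod, List.map_map, pathProd]
  congr 1
  refine List.map_congr_left fun a _ => ?_
  rw [Function.comp_apply, matrixRep_arrowElem, arrowBlock_eq_of_blockCompatible d hM]

theorem matrixRep_relElem {M : RepSpace K Q d} (hM : BlockCompatible K Q d M) (c : QPath Q →₀ K) :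
    matrixRep d M (relElem K Q c) = relEval K Q d M c := by
  rw [relElem, relEval, Finsupp.sum, map_sum, Finsupp.sum]
  exact Finset.sum_congr rfl fun p _ => by rw [map_smul, matrixRep_pathElem d hM]

theorem blockCompatible_arrowBlock (M : RepSpace K Q d) :
    BlockCompatible K Q d fun a => arrowBlock d a (M a) := by
  intro a u v h
  by_contra h0
  exact h (if_neg h0)

end

section Zariski

variable {d : Q.V → ℕ}

/-- The coordinate vector of a tuple of matrices. -/
def repCoord (M : RepSpace K Q d) : Q.A × RepIx Q d × RepIx Q d → K := fun x => M x.1 x.2.1 x.2.2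

theorem isOpen_eval_ne_zero (f : MvPolynomial (Q.A × RepIx Q d × RepIx Q d) K) :
    @IsOpen _ (repTopology K Q d) {M | MvPolynomial.eval (repCoord M) f ≠ 0} :=
  ⟨{x | MvPolynomial.eval x f ≠ 0}, TopologicalSpace.GenerateOpen.basic _ ⟨f, rfl⟩, rfl⟩

theorem exists_eval_ne_zero_subset {U : Set (RepSpace K Q d)} (hU : @IsOpen _ (repTopology K Q d) U)
    {M : RepSpace K Q d} (hM : M ∈ U) :
    ∃ f : MvPolynomial (Q.A × RepIx Q d × RepIx Q d) K, MvPolynomial.eval (repCoord M) f ≠ 0 ∧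
      ∀ N, MvPolynomial.eval (repCoord N) f ≠ 0 → N ∈ U := by
  obtain ⟨V, hV, rfl⟩ := hU
  have key : ∀ x ∈ V, ∃ f : MvPolynomial (Q.A × RepIx Q d × RepIx Q d) K,
      MvPolynomial.eval x f ≠ 0 ∧ ∀ y, MvPolynomial.eval y f ≠ 0 → y ∈ V := by
    clear hM
    change TopologicalSpace.GenerateOpen _ V at hV
    induction hV with
    | basic s hs =>
      obtain ⟨f, rfl⟩ := hs
      exact fun x hx => ⟨f, hx, fun y hy => hy⟩
    | univ => exact fun x _ => ⟨1, by simp, fun _ _ => trivial⟩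
    | inter s t _ _ hs ht =>
      rintro x ⟨hxs, hxt⟩
      obtain ⟨f, hf, hf'⟩ := hs x hxs
      obtain ⟨g, hg, hg'⟩ := ht x hxt
      refine ⟨f * g, ?_, fun y hy => ?_⟩
      · rw [map_mul]; exact mul_ne_zero hf hg
      · rw [map_mul] at hy
        exact ⟨hf' y (left_ne_zero_of_mul hy), hg' y (right_ne_zero_of_mul hy)⟩
    | sUnion S _ hS =>
      rintro x ⟨s, hs, hxs⟩
      obtain ⟨f, hf, hf'⟩ := hS s hs x hxs
      exact ⟨f, hf, fun y hy => ⟨s, hs, hf' y hy⟩⟩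
  obtain ⟨f, hf, hf'⟩ := key _ hM
  exact ⟨f, hf, fun N hN => hf' _ hN⟩

theorem isIrreducible_blockCompatible [Infinite K] :
    @IsIrreducible _ (repTopology K Q d) {M | BlockCompatible K Q d M} := by
  let τ : (Q.A × RepIx Q d × RepIx Q d) → MvPolynomial (Q.A × RepIx Q d × RepIx Q d) K :=
    fun x => if x.2.1.1 = Q.tgt x.1 ∧ x.2.2.1 = Q.src x.1 then MvPolynomial.X x else 0
  have hτ : ∀ (M : RepSpace K Q d) (f : MvPolynomial (Q.A × RepIx Q d × RepIx Q d) K),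
      MvPolynomial.eval (repCoord M) (MvPolynomial.aeval τ f) =
        MvPolynomial.eval (repCoord fun a => arrowBlock d a (M a)) f := by
    intro M f
    induction f using MvPolynomial.induction_on with
    | C c => simp
    | add p q hp hq => rw [map_add, map_add, map_add, hp, hq]
    | mul_X p x hp =>
      rw [map_mul, map_mul, map_mul, hp, MvPolynomial.aeval_X, MvPolynomial.eval_X]
      congr 1
      simp only [τ, repCoord, arrowBlock, Matrix.of_apply]
      split_ifs
      · rw [MvPolynomial.eval_X, repCoord]
      · rw [map_zero]
  have hcompat : ∀ {M : RepSpace K Q d}, BlockCompatible K Q d M →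
      (fun a => arrowBlock d a (M a)) = M :=
    fun hM => funext fun a => arrowBlock_eq_of_blockCompatible d hM a
  let := repTopology K Q d
  refine ⟨⟨0, fun a u v h => absurd rfl h⟩, ?_⟩
  rintro U V hU hV ⟨M, hM, hMU⟩ ⟨N, hN, hNV⟩
  obtain ⟨f, hf, hfU⟩ := exists_eval_ne_zero_subset hU hMU
  obtain ⟨g, hg, hgV⟩ := exists_eval_ne_zero_subset hV hNV
  have hf0 : MvPolynomial.aeval τ f ≠ 0 := by
    intro h0
    have := hτ M f
    rw [h0, map_zero, hcompat hM] at this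
    exact hf this.symm
  have hg0 : MvPolynomial.aeval τ g ≠ 0 := by
    intro h0
    have := hτ N g
    rw [h0, map_zero, hcompat hN] at this
    exact hg this.symm
  obtain ⟨x, hx⟩ : ∃ x, MvPolynomial.eval x (MvPolynomial.aeval τ f * MvPolynomial.aeval τ g) ≠ 0 := by
    by_contra! h
    exact mul_ne_zero hf0 hg0 (MvPolynomial.funext fun x => by rw [h x, map_zero])
  let P : RepSpace K Q d := fun a => Matrix.of fun u v => x (a, u, v)
  have hP : x = repCoord P := rfl
  rw [map_mul, hP, hτ, hτ] at hx
  exact ⟨_, blockCompatible_arrowBlock d P, hfU _ (left_ne_zero_of_mul hx),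
    hgV _ (right_ne_zero_of_mul hx)⟩

end Zariski

variable {A : Type} [Ring A] [Algebra K A] {φ : PathAlgebra K Q →ₐ[K] A}

theorem isGeomIrreducible_of_isHereditaryRing [Infinite K] (h : IsAdmissiblePresentation K Q φ)
    (hA : IsHereditaryRing A) : IsGeomIrreducible K Q φ := by
  intro d
  have : RepSet K Q φ d = {M | BlockCompatible K Q d M} := by
    ext M
    refine ⟨fun hM => hM.1, fun hM => ⟨hM, fun c i j _ h0 => ?_⟩⟩
    rw [← matrixRep_relElem d hM, injective_of_isHereditaryRing h hA h0, map_zero]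
  rw [this]
  exact isIrreducible_blockCompatible

end MatrixRepresentations

section Points

variable {K : Type} [Field K] {Q : FinQuiver} {d : Q.V → ℕ}

theorem matrixRep_eq {g : PathAlgebra K Q →ₐ[K] Matrix (RepIx Q d) (RepIx Q d) K}
    (hg : ∀ i, g (vertexElem K Q i) = Matrix.diagonal fun u => if u.1 = i then 1 else 0)
    (x : PathAlgebra K Q) : matrixRep d (fun a => g (arrowElem K Q a)) x = g x := by
  refine PathAlgebra.algHom_eq (fun i => ?_) (fun a => ?_) x
  · rw [matrixRep_vertexElem, hg]
  · have h1 : g (vertexElem K Q (Q.tgt a) * arrowElem K Q a * vertexElem K Q (Q.src a)) =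
        g (arrowElem K Q a) := by
      rw [vertexElem_tgt_mul_arrowElem, arrowElem_mul_vertexElem_src]
    rw [matrixRep_arrowElem]
    conv_rhs => rw [← h1, map_mul, map_mul, hg, hg]
    ext u v
    rw [Matrix.mul_diagonal, Matrix.diagonal_mul]
    by_cases hu : u.1 = Q.tgt a <;> by_cases hv : v.1 = Q.src a <;> simp [arrowBlock, hu, hv]

variable {A : Type} [Ring A] [Algebra K A] {φ : PathAlgebra K Q →ₐ[K] A}
variable {N : Type} [AddCommGroup N] [Module K N] [Module A N] [IsScalarTower K A N]

theorem IsAdmissiblePresentation.exists_point (h : IsAdmissiblePresentation K Q φ)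
    [FiniteDimensional K N]
    (hd : ∀ j, Module.finrank K (fixedSpace K N (φ (vertexElem K Q j))) = d j) :
    ∃ M ∈ RepSet K Q φ d, ∃ θ : N ≃ₗ[K] (RepIx Q d → K),
      ∀ x n, θ (φ x • n) = (matrixRep d M x).mulVec (θ n) := by
  have hb := h.isBasicData
  let β := fun j => Module.finBasisOfFinrankEq K (fixedSpace K N (φ (vertexElem K Q j))) (hd j)
  let E : N ≃ₗ[K] ∀ j, fixedSpace K N (φ (vertexElem K Q j)) :=
    { toFun := fun n j => ⟨φ (vertexElem K Q j) • n, smul_mem_fixedSpace (hb.idem j) n⟩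
      invFun := fun f => ∑ j, (f j : N)
      map_add' := fun x y => funext fun j => Subtype.ext (smul_add _ x y)
      map_smul' := fun c x => funext fun j => Subtype.ext (smul_comm _ c x)
      left_inv := fun n => hb.sum_smul n
      right_inv := fun f => by
        funext j
        refine Subtype.ext ?_
        change φ (vertexElem K Q j) • ∑ k, (f k : N) = f j
        rw [Finset.smul_sum, Finset.sum_eq_single j]
        · exact (f j).2
        · intro k _ hk
          rw [← mem_fixedSpace.1 (f k).2, ← mul_smul, hb.orth j k hk.symm, zero_smul]
        · simp }
  let b : Module.Basis (RepIx Q d) K N := (Pi.basis β).map E.symm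
  have hbu : ∀ u, b u = (β u.1 u.2 : N) := by
    intro u
    change ∑ j, ((Pi.basis β u j : fixedSpace K N (φ (vertexElem K Q j))) : N) = _
    rw [Finset.sum_eq_single u.1]
    · simp [Pi.basis_apply]
    · intro j _ hj
      simp [Pi.basis_apply, Pi.single_eq_of_ne hj]
    · simp
  let g : PathAlgebra K Q →ₐ[K] Matrix (RepIx Q d) (RepIx Q d) K :=
    ((LinearMap.toMatrixAlgEquiv b).toAlgHom.comp (Algebra.lsmul K K N)).comp φ
  have hg : ∀ i, g (vertexElem K Q i) = Matrix.diagonal fun u => if u.1 = i then 1 else 0 := by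
    intro i
    ext u v
    change LinearMap.toMatrixAlgEquiv b (Algebra.lsmul K K N (φ (vertexElem K Q i))) u v = _
    rw [LinearMap.toMatrixAlgEquiv_apply]
    change b.repr (φ (vertexElem K Q i) • b v) u = _
    have hv : φ (vertexElem K Q v.1) • b v = b v := by rw [hbu]; exact (β v.1 v.2).2
    by_cases hvi : v.1 = i
    · rw [← hvi, hv, b.repr_self, Finsupp.single_apply, Matrix.diagonal_apply]
      by_cases huv : v = u
      · subst huv; simp
      · rw [if_neg huv, if_neg (Ne.symm huv)]
    · rw [← hv, ← mul_smul, hb.orth i v.1 (Ne.symm hvi), zero_smul, map_zero,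
        Matrix.diagonal_apply]
      split_ifs with h1 h2
      · exact absurd (h1 ▸ h2) hvi
      · rfl
      · rfl
  have hcompat : BlockCompatible K Q d fun a => g (arrowElem K Q a) := by
    have := blockCompatible_arrowBlock d fun a => g (arrowElem K Q a)
    convert this using 2 with a
    exact (matrixRep_eq hg _).symm.trans (matrixRep_arrowElem d _ a)
  refine ⟨fun a => g (arrowElem K Q a), ⟨hcompat, fun c i j _ h0 => ?_⟩, b.equivFun, ?_⟩
  · rw [← matrixRep_relElem d hcompat, matrixRep_eq hg]
    change LinearMap.toMatrixAlgEquiv b (Algebra.lsmul K K N (φ (relElem K Q c))) = 0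
    rw [h0, map_zero, map_zero]
  · intro x n
    rw [matrixRep_eq hg]
    exact (LinearMap.toMatrix_mulVec_repr b b (Algebra.lsmul K K N (φ x)) n).symm

end Points

section Generic

variable {K : Type} [Field K]

theorem exists_polynomial_linearIndependent {σ ι T : Type} [Fintype ι] [Fintype T]
    (v : T → ι → MvPolynomial σ K) (x₀ : σ → K)
    (h : LinearIndependent K fun t u => MvPolynomial.eval x₀ (v t u)) :
    ∃ f : MvPolynomial σ K, MvPolynomial.eval x₀ f ≠ 0 ∧ ∀ x, MvPolynomial.eval x f ≠ 0 →
      LinearIndependent K fun t u => MvPolynomial.eval x (v t u) := by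
  classical
  let V : Matrix ι T (MvPolynomial σ K) := Matrix.of fun u t => v t u
  let l : (T → K) →ₗ[K] (ι → K) := Fintype.linearCombination K fun t u => MvPolynomial.eval x₀ (v t u)
  obtain ⟨s, hs⟩ := l.exists_leftInverse_of_injective
    (LinearMap.ker_eq_bot.2 h.fintypeLinearCombination_injective)
  let C : Matrix T ι K := LinearMap.toMatrix' s
  let P : Matrix T ι (MvPolynomial σ K) := C.map MvPolynomial.C
  have hl : l = Matrix.toLin' (V.map (MvPolynomial.eval x₀)) := by
    refine LinearMap.pi_ext' fun t => LinearMap.ext_ring ?_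
    ext u
    simp [l, V]
  have hC : C * V.map (MvPolynomial.eval x₀) = 1 := by
    rw [hl] at hs
    have := congrArg LinearMap.toMatrix' hs
    rwa [LinearMap.toMatrix'_comp, LinearMap.toMatrix'_toLin', LinearMap.toMatrix'_id] at this
  have hdet : ∀ x, MvPolynomial.eval x (P * V).det =
      (C * V.map (MvPolynomial.eval x)).det := by
    intro x
    rw [RingHom.map_det, RingHom.mapMatrix_apply, Matrix.map_mul]
    congr 2
    ext i j
    simp [P]
  refine ⟨(P * V).det, ?_, fun x hx => ?_⟩
  · rw [hdet, hC, Matrix.det_one]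
    exact one_ne_zero
  · rw [hdet] at hx
    rw [Fintype.linearIndependent_iff]
    intro g hg
    have h1 : (C * V.map (MvPolynomial.eval x)).mulVec g = 0 := by
      rw [← Matrix.mulVec_mulVec]
      have : (V.map (MvPolynomial.eval x)).mulVec g = 0 := by
        rw [← hg]
        ext u
        simp [Matrix.mulVec, dotProduct, V, Finset.sum_apply, mul_comm]
      rw [this, Matrix.mulVec_zero]
    exact congrFun (Matrix.eq_zero_of_mulVec_eq_zero hx h1)

variable {Q : FinQuiver} {d : Q.V → ℕ}

theorem exists_polynomial_linearIndependent_matrixRep {T : Type} [Fintype T]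
    (y : T → PathAlgebra K Q) (w : T → RepIx Q d → K) (M₀ : RepSpace K Q d)
    (h : LinearIndependent K fun t => (matrixRep d M₀ (y t)).mulVec (w t)) :
    ∃ f : MvPolynomial (Q.A × RepIx Q d × RepIx Q d) K,
      MvPolynomial.eval (repCoord M₀) f ≠ 0 ∧ ∀ M, MvPolynomial.eval (repCoord M) f ≠ 0 →
        LinearIndependent K fun t => (matrixRep d M (y t)).mulVec (w t) := by
  let X : Q.A → Matrix (RepIx Q d) (RepIx Q d) (MvPolynomial (Q.A × RepIx Q d × RepIx Q d) K) :=
    fun a => Matrix.of fun u v => MvPolynomial.X (a, u, v)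
  have hX : ∀ (M : RepSpace K Q d) t u, MvPolynomial.eval (repCoord M)
      ((matrixRep d X (y t)).mulVec (fun v => MvPolynomial.C (w t v)) u) =
        (matrixRep d M (y t)).mulVec (w t) u := by
    intro M t u
    have h1 := matrixRep_map d (MvPolynomial.aeval (repCoord M)) X (y t)
    have h2 : (fun a => (X a).map (MvPolynomial.aeval (repCoord M))) = M := by
      funext a
      ext u v
      simp [X, repCoord]
    rw [h2] at h1
    rw [← h1]
    simp [Matrix.mulVec, dotProduct, MvPolynomial.aeval_eq_eval]
  obtain ⟨f, hf, hf'⟩ := exists_polynomial_linearIndependent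
    (fun t => (matrixRep d X (y t)).mulVec (fun v => MvPolynomial.C (w t v))) (repCoord M₀)
    (by simpa only [hX] using h)
  refine ⟨f, hf, fun M hM => ?_⟩
  simpa only [hX] using hf' _ hM

end Generic

section Specialization

variable {K : Type} [Field K] {Q : FinQuiver} {d : Q.V → ℕ}
variable {A : Type} [Ring A] [Algebra K A] {φ : PathAlgebra K Q →ₐ[K] A}
variable {N P : Type} [AddCommGroup N] [Module K N] [Module A N] [IsScalarTower K A N]
  [AddCommGroup P] [Module K P] [Module A P] [IsScalarTower K A P]

theorem exists_common_point (hirr : @IsIrreducible _ (repTopology K Q d) (RepSet K Q φ d))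
    {S T : Type} [Fintype S] [Fintype T] (x : S → PathAlgebra K Q) (v : S → RepIx Q d → K)
    (y : T → PathAlgebra K Q) (w : T → RepIx Q d → K) {M₁ M₂ : RepSpace K Q d}
    (h₁ : M₁ ∈ RepSet K Q φ d) (h₂ : M₂ ∈ RepSet K Q φ d)
    (hl₁ : LinearIndependent K fun s => (matrixRep d M₁ (x s)).mulVec (v s))
    (hl₂ : LinearIndependent K fun t => (matrixRep d M₂ (y t)).mulVec (w t)) :
    ∃ M ∈ RepSet K Q φ d, (LinearIndependent K fun s => (matrixRep d M (x s)).mulVec (v s)) ∧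
      LinearIndependent K fun t => (matrixRep d M (y t)).mulVec (w t) := by
  obtain ⟨f, hf, hf'⟩ := exists_polynomial_linearIndependent_matrixRep x v M₁ hl₁
  obtain ⟨g, hg, hg'⟩ := exists_polynomial_linearIndependent_matrixRep y w M₂ hl₂
  obtain ⟨M, hM, hMf, hMg⟩ := hirr.2 _ _ (isOpen_eval_ne_zero f) (isOpen_eval_ne_zero g)
    ⟨M₁, h₁, hf⟩ ⟨M₂, h₂, hg⟩
  exact ⟨M, hM, hf' M hMf, hg' M hMg⟩

theorem smul_top_eq_span (B : Submodule K A) :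
    B • (⊤ : Submodule K N) = Submodule.span K {m | ∃ b ∈ B, ∃ n : N, b • n = m} := by
  refine le_antisymm (Submodule.smul_le.2 fun b hb n _ => ?_) (Submodule.span_le.2 ?_)
  · exact Submodule.subset_span ⟨b, hb, n, rfl⟩
  · rintro _ ⟨b, hb, n, rfl⟩
    exact Submodule.smul_mem_smul hb trivial

theorem finrank_smul_top_le (h : IsAdmissiblePresentation K Q φ)
    (hirr : @IsIrreducible _ (repTopology K Q d) (RepSet K Q φ d)) [FiniteDimensional K A]
    [FiniteDimensional K N] [FiniteDimensional K P]
    (hN : ∀ j, Module.finrank K (fixedSpace K N (φ (vertexElem K Q j))) = d j)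
    (hP : ∀ j, Module.finrank K (fixedSpace K P (φ (vertexElem K Q j))) = d j)
    {L : Type} [Fintype L] (κ : L → Q.V) (ε : L → P)
    (hε : ∀ l, φ (vertexElem K Q (κ l)) • ε l = ε l)
    (hgen : ∀ p : P, ∃ a : L → A, p = ∑ l, a l • ε l)
    (B : Submodule K A) (hB : ∀ b ∈ B, ∀ a, b * a ∈ B) :
    Module.finrank K ↥(B • (⊤ : Submodule K N)) ≤
      ∑ l, Module.finrank K
        (B.map (LinearMap.mulRight K (φ (vertexElem K Q (κ l))))) := by
  obtain ⟨M₁, hM₁, θ₁, hθ₁⟩ := h.exists_point hN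
  obtain ⟨M₂, hM₂, θ₂, hθ₂⟩ := h.exists_point hP
  rw [smul_top_eq_span]
  obtain ⟨m, hm, -, hmli⟩ :=
    Submodule.exists_fun_fin_finrank_span_eq K {m | ∃ b ∈ B, ∃ n : N, b • n = m}
  choose b hbB n hbn using hm
  choose y hy using fun t => h.1 (b t)
  have hspan : Submodule.span K {p | ∃ (a : A) (l : L), a • ε l = p} = ⊤ := by
    refine eq_top_iff.2 fun p _ => ?_
    obtain ⟨a, rfl⟩ := hgen p
    exact Submodule.sum_mem _ fun l _ => Submodule.subset_span ⟨a l, l, rfl⟩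
  obtain ⟨p, hp, -, hpli⟩ := Submodule.exists_fun_fin_finrank_span_eq K {p | ∃ (a : A) (l : L), a • ε l = p}
  choose a l hal using hp
  choose x hx using fun s => h.1 (a s)
  have hl₁ : LinearIndependent K fun t => (matrixRep d M₁ (y t)).mulVec (θ₁ (n t)) := by
    have : (fun t => (matrixRep d M₁ (y t)).mulVec (θ₁ (n t))) = θ₁ ∘ m := by
      funext t
      rw [Function.comp_apply, ← hθ₁, hy, hbn]
    rw [this]
    exact hmli.map' θ₁.toLinearMap θ₁.ker
  have hl₂ : LinearIndependent K fun s => (matrixRep d M₂ (x s)).mulVec (θ₂ (ε (l s))) := by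
    have : (fun s => (matrixRep d M₂ (x s)).mulVec (θ₂ (ε (l s)))) = θ₂ ∘ p := by
      funext s
      rw [Function.comp_apply, ← hθ₂, hx, hal]
    rw [this]
    exact hpli.map' θ₂.toLinearMap θ₂.ker
  obtain ⟨M, hM, hl₁, hl₂⟩ := exists_common_point hirr _ _ _ _ hM₁ hM₂ hl₁ hl₂
  have hker : ∀ z z', φ z = φ z' → matrixRep d M z = matrixRep d M z' := by
    intro z z' hz
    rw [← sub_eq_zero, ← map_sub]
    refine h.map_eq_zero (matrixRep d M) (fun c i j hc h0 => ?_) (by rw [map_sub, hz, sub_self])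
    rw [matrixRep_relElem d hM.1, hM.2 c i j hc h0]
  obtain ⟨σ, hσ⟩ := φ.toLinearMap.exists_rightInverse_of_surjective (LinearMap.range_eq_top.2 h.1)
  have hσ' : ∀ a, φ (σ a) = a := fun a => LinearMap.congr_fun hσ a
  have hidem : ∀ l, (matrixRep d M (vertexElem K Q (κ l))).mulVec (θ₂ (ε l)) = θ₂ (ε l) := by
    intro l
    have := hθ₂ (vertexElem K Q (κ l)) (ε l)
    rw [hε, matrixRep_vertexElem] at this
    rw [matrixRep_vertexElem, ← this]
  let Γ : L → A →ₗ[K] (RepIx Q d → K) := fun l =>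
    (Matrix.mulVecBilin K K).flip (θ₂ (ε l)) ∘ₗ (matrixRep d M).toLinearMap ∘ₗ σ
  have hΓ : ∀ l z, Γ l (φ z) = (matrixRep d M z).mulVec (θ₂ (ε l)) := by
    intro l z
    change (matrixRep d M (σ (φ z))).mulVec (θ₂ (ε l)) = _
    rw [hker _ z (hσ' _)]
  let Bk : L → Submodule K A := fun l => B.map (LinearMap.mulRight K (φ (vertexElem K Q (κ l))))
  classical
  let F : (∀ l, Bk l) →ₗ[K] (RepIx Q d → K) :=
    LinearMap.lsum K (fun l => Bk l) K fun l => Γ l ∘ₗ (Bk l).subtype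
  have hF : ∀ l z, φ z ∈ B → (matrixRep d M z).mulVec (θ₂ (ε l)) ∈ LinearMap.range F := by
    intro l z hz
    have hl : φ z * φ (vertexElem K Q (κ l)) ∈ Bk l := Submodule.mem_map_of_mem hz
    refine ⟨Pi.single l ⟨_, hl⟩, (LinearMap.lsum_piSingle K (fun l => Bk l) K _ _ _).trans ?_⟩
    rw [LinearMap.comp_apply, Submodule.subtype_apply]
    dsimp only
    rw [← map_mul, hΓ, map_mul, ← Matrix.mulVec_mulVec, hidem]
  have hcard : Fintype.card (Fin (Module.finrank K
      (Submodule.span K {p | ∃ (a : A) (l : L), a • ε l = p}))) =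
      Module.finrank K (RepIx Q d → K) := by
    rw [Fintype.card_fin, hspan, finrank_top, θ₂.finrank_eq]
  have htop := hl₂.span_eq_top_of_card_eq_finrank' hcard
  have hmem : ∀ t, (matrixRep d M (y t)).mulVec (θ₁ (n t)) ∈ LinearMap.range F := by
    intro t
    have h1 : θ₁ (n t) ∈ Submodule.span K
        (Set.range fun s => (matrixRep d M (x s)).mulVec (θ₂ (ε (l s)))) := htop ▸ trivial
    generalize θ₁ (n t) = v at h1
    induction h1 using Submodule.span_induction with
    | mem v hv =>
      obtain ⟨s, rfl⟩ := hv
      simp only [Matrix.mulVec_mulVec, ← map_mul]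
      exact hF _ _ (by rw [map_mul, hy]; exact hB _ (hbB t) _)
    | zero => simp
    | add u v _ _ hu hv => rw [Matrix.mulVec_add]; exact add_mem hu hv
    | smul c v _ hv => rw [Matrix.mulVec_smul]; exact Submodule.smul_mem _ c hv
  have hli : LinearIndependent K fun t => (⟨_, hmem t⟩ : LinearMap.range F) :=
    LinearIndependent.of_comp (LinearMap.range F).subtype hl₁
  have h1 := hli.fintype_card_le_finrank
  rw [Fintype.card_fin] at h1
  refine h1.trans ((LinearMap.finrank_range_le F).trans ?_)
  rw [Module.finrank_pi_fintype]

end Specialization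

section DimensionEstimate

variable {K : Type} [Field K] {Q : FinQuiver}
variable {A : Type} [Ring A] [Algebra K A] {φ : PathAlgebra K Q →ₐ[K] A}
variable {N : Type} [AddCommGroup N] [Module K N] [Module A N] [IsScalarTower K A N]

theorem sum_sigma_fin {V R : Type} [Fintype V] [CommSemiring R] (n : V → ℕ) (f : V → R) :
    ∑ l : (k : V) × Fin (n k), f l.1 = ∑ k, (n k : R) * f k := by
  simp [Fintype.sum_sigma]

theorem finrank_add_le_finrank_smul_top [FiniteDimensional K A] [FiniteDimensional K N]
    {V L : Type} [Fintype L] {e : V → A} (he : ∀ k, e k * e k = e k) (κ : L → V)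
    (B : Submodule K A) :
    Module.finrank K ↥(B • (⊤ : Submodule K N)) +
        ∑ l, Module.finrank K (B.map (LinearMap.mulRight K (e (κ l)))) ≤
      Module.finrank K ↥(B • (⊤ : Submodule K (N × ∀ l, projLeft (e (κ l))))) := by
  classical
  let T := B • (⊤ : Submodule K (N × ∀ l, projLeft (e (κ l))))
  let Bk : L → Submodule K A := fun l => B.map (LinearMap.mulRight K (e (κ l)))
  have hBk : ∀ l, ∀ b ∈ Bk l, b ∈ projLeft (e (κ l)) := by
    rintro l _ ⟨b, -, rfl⟩
    simp [mul_assoc, he]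
  let Ψ : (↥(B • (⊤ : Submodule K N)) × ∀ l, Bk l) →ₗ[K] N × ∀ l, projLeft (e (κ l)) :=
    { toFun := fun m => (m.1.1, fun l => ⟨(m.2 l).1, hBk l _ (m.2 l).2⟩)
      map_add' := fun _ _ => rfl
      map_smul' := fun _ _ => rfl }
  have h1 : ∀ m ∈ B • (⊤ : Submodule K N), ((m, 0) : N × ∀ l, projLeft (e (κ l))) ∈ T := by
    intro m hm
    refine Submodule.smul_induction_on
      (p := fun m => ((m, 0) : N × ∀ l, projLeft (e (κ l))) ∈ T) hm (fun b hb n _ => ?_)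
      fun x y hx hy => ?_
    · have := Submodule.smul_mem_smul (N := (⊤ : Submodule K (N × ∀ l, projLeft (e (κ l)))))
        hb (n := (n, 0)) trivial
      rwa [Prod.smul_mk, smul_zero] at this
    · simpa using add_mem hx hy
  have h2 : ∀ l, ∀ b : Bk l, ((0, Pi.single l ⟨b.1, hBk l _ b.2⟩) :
      N × ∀ l, projLeft (e (κ l))) ∈ T := by
    rintro l ⟨_, b, hb, rfl⟩
    have := Submodule.smul_mem_smul (N := (⊤ : Submodule K (N × ∀ l, projLeft (e (κ l)))))
        hb (n := (0, Pi.single l ⟨e (κ l), he _⟩)) trivial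
    rwa [Prod.smul_mk, smul_zero, ← Pi.single_smul] at this
  have h3 : ∀ m, Ψ m ∈ T := by
    intro m
    have : Ψ m = (m.1.1, 0) + ∑ l, (0, Pi.single l ⟨(m.2 l).1, hBk l _ (m.2 l).2⟩) := by
      refine Prod.ext ?_ ?_
      · simp [Ψ, Prod.fst_sum]
      · rw [Prod.snd_add, Prod.snd_sum, Finset.univ_sum_single, zero_add]
        rfl
    rw [this]
    exact add_mem (h1 _ m.1.2) (Submodule.sum_mem _ fun l _ => h2 l _)
  have hinj : Function.Injective (Ψ.codRestrict T h3) := by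
    intro m m' hm
    have hm' : Ψ m = Ψ m' := congrArg Subtype.val hm
    refine Prod.ext (Subtype.ext (congrArg Prod.fst hm')) (funext fun l => Subtype.ext ?_)
    exact congrArg (Subtype.val : projLeft (e (κ l)) → A) (congrFun (congrArg Prod.snd hm') l)
  have := LinearMap.finrank_le_finrank_of_injective hinj
  rwa [Module.finrank_prod, Module.finrank_pi_fintype] at this

theorem finrank_smul_top_le_sum (h : IsAdmissiblePresentation K Q φ)
    (hirr : IsGeomIrreducible K Q φ) [FiniteDimensional K A] [FiniteDimensional K N]
    (g : Q.V → ℤ)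
    (hg : ∀ j, (Module.finrank K (fixedSpace K N (φ (vertexElem K Q j))) : ℤ) =
      ∑ k, g k * Module.finrank K
        (fixedSpace K (projLeft (φ (vertexElem K Q k))) (φ (vertexElem K Q j))))
    (B : Submodule K A) (hB : ∀ b ∈ B, ∀ a, b * a ∈ B) :
    (Module.finrank K ↥(B • (⊤ : Submodule K N)) : ℤ) ≤
      ∑ k, g k * Module.finrank K (B.map (LinearMap.mulRight K (φ (vertexElem K Q k)))) := by
  classical
  have hb := h.isBasicData
  let e : Q.V → A := fun k => φ (vertexElem K Q k)
  let np : Q.V → ℕ := fun k => (g k).toNat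
  let nm : Q.V → ℕ := fun k => (-g k).toNat
  have hgn : ∀ k, g k = np k - nm k := fun k => by simp only [np, nm]; omega
  let κp : ((k : Q.V) × Fin (np k)) → Q.V := Sigma.fst
  let κm : ((k : Q.V) × Fin (nm k)) → Q.V := Sigma.fst
  let P := ∀ l, projLeft (e (κp l))
  let N' := N × ∀ l, projLeft (e (κm l))
  let d : Q.V → ℕ := fun j => Module.finrank K (fixedSpace K P (e j))
  have hd : ∀ j, (d j : ℤ) =
      ∑ k, (np k : ℤ) * Module.finrank K (fixedSpace K (projLeft (e k)) (e j)) := by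
    intro j
    rw [← sum_sigma_fin np fun k =>
      (Module.finrank K (fixedSpace K (projLeft (e k)) (e j)) : ℤ)]
    simp only [d, P]
    rw [finrank_fixedSpace_pi]
    push_cast
    rfl
  have hN : ∀ j, Module.finrank K (fixedSpace K N' (e j)) = d j := by
    intro j
    have h1 : ∑ l, (Module.finrank K (fixedSpace K (projLeft (e (κm l))) (e j)) : ℤ) = _ :=
      sum_sigma_fin nm fun k =>
        (Module.finrank K (fixedSpace K (projLeft (e k)) (e j)) : ℤ)
    zify
    rw [hd, finrank_fixedSpace_prod, finrank_fixedSpace_pi]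
    push_cast
    rw [h1, hg, ← Finset.sum_add_distrib]
    refine Finset.sum_congr rfl fun k _ => ?_
    rw [hgn]
    simp only [e]
    ring
  have key := finrank_smul_top_le (N := N') (P := P) h (hirr d) hN (fun _ => rfl) κp
    (fun l => hb.gen κp l) (fun l => hb.smul_gen κp l)
    (fun p => ⟨fun l => (p l : A), (hb.sum_smul_gen κp p).symm⟩) B hB
  have key' := (finrank_add_le_finrank_smul_top (N := N) hb.idem κm B).trans key
  zify at key'
  have hp := sum_sigma_fin np fun k =>
    (Module.finrank K (B.map (LinearMap.mulRight K (e k))) : ℤ)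
  have hm := sum_sigma_fin nm fun k =>
    (Module.finrank K (B.map (LinearMap.mulRight K (e k))) : ℤ)
  have hsum : ∑ k, g k * (Module.finrank K (B.map (LinearMap.mulRight K (e k))) : ℤ) =
      ∑ k, (np k : ℤ) * (Module.finrank K (B.map (LinearMap.mulRight K (e k))) : ℤ) -
      ∑ k, (nm k : ℤ) * (Module.finrank K (B.map (LinearMap.mulRight K (e k))) : ℤ) := by
    rw [← Finset.sum_sub_distrib]
    exact Finset.sum_congr rfl fun k _ => by rw [hgn]; ring
  simp only [e, κp, κm] at key' hp hm hsum
  rw [hsum, ← hp, ← hm]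
  linarith

end DimensionEstimate

section DimensionVectors

variable {K A V : Type} [Field K] [Ring A] [Algebra K A] [Fintype V]
variable {e : V → A} {r : Submodule A A}

/-- In an algebra of finite global dimension, dimension vectors are integral combinations of the
dimension vectors of the indecomposable projective modules. -/
theorem IsBasicData.exists_dimension_eq_sum (h : IsBasicData K e r) [FiniteDimensional K A]
    (n : ℕ) (M : Type) [AddCommGroup M] [Module K M] [Module A M] [IsScalarTower K A M]
    [FiniteDimensional K M] (hM : ProjDimLT A M (n + 1)) :
    ∃ g : V → ℤ, ∀ j, (Module.finrank K (fixedSpace K M (e j)) : ℤ) =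
      ∑ k, g k * Module.finrank K (fixedSpace K (projLeft (e k)) (e j)) := by
  classical
  induction n generalizing M with
  | zero =>
    have := projDimLT_one_iff.1 hM
    obtain ⟨L, _, κ, π, hs, hk⟩ := h.exists_projectiveCover (M := M)
    let E := LinearEquiv.ofBijective π ⟨h.injective_of_ker_le κ π hs hk, hs⟩
    refine ⟨fun k => ∑ l, if κ l = k then 1 else 0, fun j => ?_⟩
    rw [← finrank_fixedSpace_of_equiv E, finrank_fixedSpace_pi]
    push_cast
    simp only [Finset.sum_mul]
    rw [Finset.sum_comm]
    simp
  | succ n ih =>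
    let b := Module.finBasis K M
    have hs : Function.Surjective (Fintype.linearCombination A b) := by
      intro m
      refine ⟨fun i => algebraMap K A (b.repr m i), ?_⟩
      simp [Fintype.linearCombination_apply, b.sum_repr]
    have : FiniteDimensional K (LinearMap.ker (Fintype.linearCombination A b)) :=
      FiniteDimensional.finiteDimensional_submodule
        ((LinearMap.ker (Fintype.linearCombination A b)).restrictScalars K)
    obtain ⟨g₁, hg₁⟩ := ih _ (projDimLT_ker hs (projDimLT_of_projective n) hM)
    have hA : ∃ g : V → ℤ, ∀ j,
        (Module.finrank K (fixedSpace K (Fin (Module.finrank K M) → A) (e j)) : ℤ) =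
          ∑ k, g k * Module.finrank K (fixedSpace K (projLeft (e k)) (e j)) := by
      have := ih (Fin (Module.finrank K M) → A) (projDimLT_of_projective n)
      exact this
    obtain ⟨g₂, hg₂⟩ := hA
    refine ⟨fun k => g₂ k - g₁ k, fun j => ?_⟩
    have := finrank_fixedSpace_eq_add_ker (K := K) (h.idem j) hs
    zify at this
    rw [hg₁, hg₂] at this
    simp only [sub_mul, Finset.sum_sub_distrib]
    linarith

end DimensionVectors

section RadicalLayers

variable {K A V : Type} [Field K] [Ring A] [Algebra K A] [Fintype V]
variable {e : V → A} {r : Submodule A A}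

/-- The submodule `r x` of `A x` for an idempotent `x` and a two-sided ideal `r`. -/
def radLeft (r : Submodule A A) (x : A) : Submodule A (projLeft x) :=
  r.comap (projLeft x).subtype

@[simp] theorem mem_radLeft {x : A} {a : projLeft x} : a ∈ radLeft r x ↔ (a : A) ∈ r := Iff.rfl

instance finiteDimensional_submodule [FiniteDimensional K A] {M : Type} [AddCommGroup M]
    [Module K M] [Module A M] [IsScalarTower K A M] [FiniteDimensional K M] (S : Submodule A M) :
    FiniteDimensional K S :=
  FiniteDimensional.finiteDimensional_submodule (S.restrictScalars K)

/-- The right ideal `e_j r (1 - e_i) A`. -/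
def cornerIdeal (K : Type) [Field K] [Algebra K A] (r : Submodule A A) (x y : A) :
    Submodule K A :=
  Submodule.span K {b | ∃ s ∈ r, ∃ a, x * s * (1 - y) * a = b}

theorem mul_mem_cornerIdeal {x y b : A} (hb : b ∈ cornerIdeal K r x y) (a : A) :
    b * a ∈ cornerIdeal K r x y := by
  induction hb using Submodule.span_induction with
  | mem b hb =>
    obtain ⟨s, hs, c, rfl⟩ := hb
    exact Submodule.subset_span ⟨s, hs, c * a, by simp only [mul_assoc]⟩
  | zero => simp
  | add u v _ _ hu hv => rw [add_mul]; exact add_mem hu hv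
  | smul c v _ hv => rw [smul_mul_assoc]; exact Submodule.smul_mem _ c hv

theorem exists_span_sup_of_le {M : Type} [AddCommGroup M] [Module K M] [FiniteDimensional K M]
    {X Y : Submodule K M} (hYX : Y ≤ X) :
    ∃ n : ℕ, n + Module.finrank K Y = Module.finrank K X ∧
      ∃ x : Fin n → M, (∀ i, x i ∈ X) ∧ X ≤ Submodule.span K (Set.range x) ⊔ Y := by
  obtain ⟨C, hC⟩ := Submodule.exists_isCompl (Y.comap X.subtype)
  have h1 := Submodule.finrank_add_eq_of_isCompl hC
  rw [(Submodule.comapSubtypeEquivOfLe hYX).finrank_eq] at h1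
  let b := Module.finBasis K C
  refine ⟨Module.finrank K C, by omega, fun i => ((b i : X) : M), fun i => (b i : X).2, ?_⟩
  intro m hm
  have htop : (⟨m, hm⟩ : X) ∈ Y.comap X.subtype ⊔ C := by
    rw [hC.sup_eq_top]
    trivial
  obtain ⟨y, hy, c, hc, hyc⟩ := Submodule.mem_sup.1 htop
  rw [sup_comm]
  refine Submodule.mem_sup.2 ⟨y, hy, c, ?_, congrArg (Subtype.val : X → M) hyc⟩
  have h2 : (⟨c, hc⟩ : C) ∈ Submodule.span K (Set.range b) := b.span_eq ▸ trivial
  have h3 := Submodule.mem_map_of_mem (f := X.subtype ∘ₗ C.subtype) h2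
  rw [Submodule.map_span, ← Set.range_comp] at h3
  exact h3

namespace IsBasicData

theorem finrank_fixedSpace_projLeft [FiniteDimensional K A] [DecidableEq V]
    (h : IsBasicData K e r) (j k : V) :
    Module.finrank K (fixedSpace K (projLeft (e k)) (e j)) =
      Module.finrank K (fixedSpace K (radLeft r (e k)) (e j)) + if k = j then 1 else 0 := by
  have h1 := finrank_fixedSpace_eq_add_ker (K := K) (h.idem j)
    (Submodule.mkQ_surjective (radLeft r (e k)))
  rw [Submodule.ker_mkQ] at h1
  rw [h1, add_comm]
  congr 1
  have hmem : e k ∈ projLeft (e k) := h.idem k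
  have hmk : ∀ x : projLeft (e k) ⧸ radLeft r (e k), ∃ c : K,
      x = c • (radLeft r (e k)).mkQ ⟨e k, hmem⟩ := by
    intro x
    obtain ⟨a, rfl⟩ := Submodule.mkQ_surjective _ x
    obtain ⟨c, hc⟩ := h.exists_smul_sub_mem a.2
    refine ⟨c, ?_⟩
    change Submodule.Quotient.mk a = Submodule.Quotient.mk (c • ⟨e k, hmem⟩)
    rw [Submodule.Quotient.eq]
    exact hc
  split_ifs with hkj
  · subst hkj
    refine finrank_eq_one ⟨(radLeft r (e k)).mkQ ⟨e k, hmem⟩, ?_⟩ ?_ ?_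
    · rw [mem_fixedSpace, ← map_smul]
      congr 1
      exact Subtype.ext (h.idem k)
    · intro h0
      have h0' : (radLeft r (e k)).mkQ ⟨e k, hmem⟩ = 0 := congrArg Subtype.val h0
      exact h.not_mem k ((Submodule.Quotient.mk_eq_zero (radLeft r (e k))).1 h0')
    · intro w
      obtain ⟨c, hc⟩ := hmk w.1
      exact ⟨c, Subtype.ext hc.symm⟩
  · have : Subsingleton (fixedSpace K (projLeft (e k) ⧸ radLeft r (e k)) (e j)) := by
      refine ⟨fun x y => ?_⟩
      have hz : ∀ z : fixedSpace K (projLeft (e k) ⧸ radLeft r (e k)) (e j), z.1 = 0 := by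
        intro z
        obtain ⟨c, hc⟩ := hmk z.1
        have h2 : e j • (⟨e k, hmem⟩ : projLeft (e k)) = 0 :=
          Subtype.ext (h.orth j k (Ne.symm hkj))
        rw [← mem_fixedSpace.1 z.2, hc, smul_comm, ← map_smul, h2, map_zero, smul_zero]
      exact Subtype.ext ((hz x).trans (hz y).symm)
    exact Module.finrank_zero_of_subsingleton

/-- The space `B e_i`, where `B = e_j r (1 - e_i) A`, is contained in `B · r e_i`. -/
theorem exists_smul_top_of_mem_map (h : IsBasicData K e r) {i j : V} {b : A}
    (hb : b ∈ (cornerIdeal K r (e j) (e i)).map (LinearMap.mulRight K (e i))) :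
    ∃ m ∈ cornerIdeal K r (e j) (e i) • (⊤ : Submodule K (radLeft r (e i))),
      ((m : projLeft (e i)) : A) = b := by
  obtain ⟨c, hc, rfl⟩ := hb
  induction hc using Submodule.span_induction with
  | mem b hb =>
    obtain ⟨s, hs, a, rfl⟩ := hb
    have hmem : (1 - e i) * (a * e i) ∈ projLeft (e i) := by simp [mul_assoc, h.idem]
    have hr : (1 - e i) * (a * e i) ∈ r := by
      obtain ⟨c, hc⟩ := h.exists_smul_sub_mem (k := i) (a := a * e i) (by rw [mul_assoc, h.idem])
      have := r.smul_mem (1 - e i) hc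
      rwa [smul_eq_mul, mul_sub, mul_smul_comm, sub_mul 1 (e i) (e i), one_mul, h.idem, sub_self,
        smul_zero, sub_zero] at this
    have hs' : e j * s * (1 - e i) * 1 ∈ cornerIdeal K r (e j) (e i) :=
      Submodule.subset_span ⟨s, hs, 1, rfl⟩
    let n : radLeft r (e i) := ⟨⟨_, hmem⟩, hr⟩
    refine ⟨_, Submodule.smul_mem_smul hs' (n := n) trivial, ?_⟩
    have hid : (1 - e i) * (1 - e i) = 1 - e i := by
      simp [mul_sub, sub_mul, h.idem]
    change e j * s * (1 - e i) * 1 * ((1 - e i) * (a * e i)) = e j * s * (1 - e i) * a * e i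
    rw [mul_one, ← mul_assoc, mul_assoc (e j * s), hid, mul_assoc _ a]
  | zero => exact ⟨0, zero_mem _, by simp⟩
  | add u v _ _ hu hv =>
    obtain ⟨m, hm, hm'⟩ := hu
    obtain ⟨n, hn, hn'⟩ := hv
    exact ⟨m + n, add_mem hm hn, by simp [hm', hn', add_mul]⟩
  | smul c v _ hv =>
    obtain ⟨m, hm, hm'⟩ := hv
    exact ⟨c • m, Submodule.smul_mem _ c hm, by simp [hm']⟩

theorem finrank_map_cornerIdeal_le [FiniteDimensional K A] (h : IsBasicData K e r) (i j : V) :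
    Module.finrank K ((cornerIdeal K r (e j) (e i)).map (LinearMap.mulRight K (e i))) ≤
      Module.finrank K ↥(cornerIdeal K r (e j) (e i) •
        (⊤ : Submodule K (radLeft r (e i)))) := by
  let ι : radLeft r (e i) →ₗ[K] A :=
    ((projLeft (e i)).subtype ∘ₗ (radLeft r (e i)).subtype).restrictScalars K
  have hle : (cornerIdeal K r (e j) (e i)).map (LinearMap.mulRight K (e i)) ≤
      (cornerIdeal K r (e j) (e i) • (⊤ : Submodule K (radLeft r (e i)))).map ι := by
    intro b hb
    obtain ⟨m, hm, hm'⟩ := h.exists_smul_top_of_mem_map hb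
    exact ⟨m, hm, hm'⟩
  exact (Submodule.finrank_mono hle).trans (Submodule.finrank_map_le _ _)

theorem mem_of_mem_cornerIdeal (h : IsBasicData K e r) {i j : V} {b : A}
    (hb : b ∈ cornerIdeal K r (e j) (e i)) : b ∈ r ∧ e j * b = b := by
  have hle : cornerIdeal K r (e j) (e i) ≤ r.restrictScalars K := by
    rw [cornerIdeal, Submodule.span_le]
    rintro _ ⟨s, hs, a, rfl⟩
    exact h.mul_mem _ (h.mul_mem _ (r.smul_mem (e j) hs) _) _
  refine ⟨hle hb, ?_⟩
  induction hb using Submodule.span_induction with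
  | mem b hb =>
    obtain ⟨s, hs, a, rfl⟩ := hb
    simp only [← mul_assoc, h.idem]
  | zero => simp
  | add u v _ _ hu hv => rw [mul_add, hu, hv]
  | smul c v _ hv => rw [mul_smul_comm, hv]

theorem finrank_map_cornerIdeal [FiniteDimensional K A] (h : IsBasicData K e r) {i j k : V}
    (hk : k ≠ i) :
    Module.finrank K ((cornerIdeal K r (e j) (e i)).map (LinearMap.mulRight K (e k))) =
      Module.finrank K (fixedSpace K (radLeft r (e k)) (e j)) := by
  let ι : radLeft r (e k) →ₗ[K] A :=
    ((projLeft (e k)).subtype ∘ₗ (radLeft r (e k)).subtype).restrictScalars K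
  have hι : Function.Injective ι := fun x y hxy => Subtype.ext (Subtype.ext hxy)
  rw [(Submodule.equivMapOfInjective ι hι _).finrank_eq]
  suffices heq : (cornerIdeal K r (e j) (e i)).map (LinearMap.mulRight K (e k)) =
      (fixedSpace K (radLeft r (e k)) (e j)).map ι by rw [heq]
  apply le_antisymm
  · rintro _ ⟨b, hb, rfl⟩
    obtain ⟨hbr, hbj⟩ := h.mem_of_mem_cornerIdeal hb
    have h1 : b * e k ∈ projLeft (e k) := by simp [mul_assoc, h.idem]
    let n : radLeft r (e k) := ⟨⟨_, h1⟩, h.mul_mem _ hbr _⟩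
    refine ⟨n, Subtype.ext (Subtype.ext ?_), rfl⟩
    change e j * (b * e k) = b * e k
    rw [← mul_assoc, hbj]
  · rintro _ ⟨m, hm, rfl⟩
    have hk' : ι m * e k = ι m := m.1.2
    have hj : e j * ι m = ι m := congrArg ι hm
    refine ⟨e j * ι m * (1 - e i) * 1, Submodule.subset_span ⟨_, m.2, 1, rfl⟩, ?_⟩
    rw [LinearMap.mulRight_apply, mul_one, mul_assoc, sub_mul, h.orth i k (Ne.symm hk), one_mul,
      sub_zero, hj, hk']

theorem smul_top_cornerIdeal_le (h : IsBasicData K e r) (i j : V) {M : Type} [AddCommGroup M]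
    [Module K M] [Module A M] [IsScalarTower K A M] :
    cornerIdeal K r (e j) (e i) • (⊤ : Submodule K M) ≤
      fixedSpace K M (e j) ⊓ r.restrictScalars K • (⊤ : Submodule K M) := by
  refine Submodule.smul_le.2 fun b hb m _ => ?_
  obtain ⟨hbr, hbj⟩ := h.mem_of_mem_cornerIdeal hb
  refine ⟨?_, Submodule.smul_mem_smul hbr trivial⟩
  rw [SetLike.mem_coe, mem_fixedSpace, ← mul_smul, hbj]

end IsBasicData
end RadicalLayers

section Hereditary

variable {K : Type} [Field K] {Q : FinQuiver}
variable {A : Type} [Ring A] [Algebra K A] {φ : PathAlgebra K Q →ₐ[K] A}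

/-- The numbers of generators of the radicals of the indecomposable projective modules agree with
the coefficients of their dimension vectors. -/
theorem coeff_eq_of_isGeomIrreducible (h : IsAdmissiblePresentation K Q φ)
    (hirr : IsGeomIrreducible K Q φ) [FiniteDimensional K A] (i : Q.V) (g : Q.V → ℤ)
    (hg : ∀ j, (Module.finrank K (fixedSpace K (radLeft (arrowIdeal φ h.1)
        (φ (vertexElem K Q i))) (φ (vertexElem K Q j))) : ℤ) =
      ∑ k, g k * Module.finrank K
        (fixedSpace K (projLeft (φ (vertexElem K Q k))) (φ (vertexElem K Q j))))
    (n : Q.V → ℕ)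
    (hn : ∀ j, n j + Module.finrank K ↥(cornerIdeal K (arrowIdeal φ h.1) (φ (vertexElem K Q j))
        (φ (vertexElem K Q i)) •
          (⊤ : Submodule K (radLeft (arrowIdeal φ h.1) (φ (vertexElem K Q i))))) =
      Module.finrank K (fixedSpace K (radLeft (arrowIdeal φ h.1)
        (φ (vertexElem K Q i))) (φ (vertexElem K Q j)))) (j : Q.V) : g j = n j := by
  have hb := h.isBasicData
  set e : Q.V → A := fun k => φ (vertexElem K Q k) with he
  set r := arrowIdeal φ h.1
  let R := radLeft r (e i)
  let S := projLeft (e i) ⧸ R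
  have key : ∀ j, g j = (1 - g i) * n j := by
    intro j
    let B := cornerIdeal K r (e j) (e i)
    let b : Q.V → ℤ := fun k => Module.finrank K (B.map (LinearMap.mulRight K (e k)))
    have hB : ∀ b ∈ B, ∀ a, b * a ∈ B := fun b hb a => mul_mem_cornerIdeal hb a
    have h1 := finrank_smul_top_le_sum h hirr g hg B hB
    have h2 := finrank_smul_top_le_sum (N := S) h hirr
      (fun k => (if k = i then 1 else 0) - g k) (fun l => by
        have h3 := finrank_fixedSpace_eq_add_ker (K := K) (hb.idem l)
          (Submodule.mkQ_surjective R)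
        rw [Submodule.ker_mkQ] at h3
        zify at h3
        have h4 := hg l
        simp only [sub_mul, Finset.sum_sub_distrib, ite_mul, one_mul, zero_mul,
          Finset.sum_ite_eq', Finset.mem_univ, if_true]
        linarith) B hB
    simp only [sub_mul, Finset.sum_sub_distrib, ite_mul, one_mul, zero_mul,
          Finset.sum_ite_eq', Finset.mem_univ, if_true] at h2
    have h5 : (Module.finrank K (B.map (LinearMap.mulRight K (e i))) : ℤ) ≤
        Module.finrank K ↥(B • (⊤ : Submodule K R)) := by
      exact_mod_cast hb.finrank_map_cornerIdeal_le i j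
    have h6 : (n j : ℤ) + Module.finrank K ↥(B • (⊤ : Submodule K R)) =
        Module.finrank K (fixedSpace K R (e j)) := by
      exact_mod_cast hn j
    have h7 : ∀ k, b k = Module.finrank K (fixedSpace K (projLeft (e k)) (e j)) -
        (if k = j then 1 else 0) - (if k = i then (n j : ℤ) else 0) := by
      intro k
      have h8 := hb.finrank_fixedSpace_projLeft (K := K) j k
      zify at h8
      by_cases hk : k = i
      · subst hk
        simp only [b, if_true]
        linarith
      · have := hb.finrank_map_cornerIdeal (K := K) (j := j) hk
        simp only [b, if_neg hk]
        linarith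
    have h9 : ∑ k, g k * b k = Module.finrank K (fixedSpace K R (e j)) - g j - g i * n j := by
      rw [hg j]
      simp only [h7, mul_sub, Finset.sum_sub_distrib, mul_ite, mul_zero, mul_one,
          Finset.sum_ite_eq', Finset.mem_univ, if_true]
      rfl
    simp only [b] at h9
    have h10 : (0 : ℤ) ≤ Module.finrank K ↥(B • (⊤ : Submodule K S)) := Int.natCast_nonneg _
    simp only [he] at *
    linarith
  have hi := key i
  have hgi : g i = 0 := by
    have h1 : (1 - g i) * (1 + n i) = 1 := by linarith
    have h2 : (1 + n i : ℤ) = 1 := by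
      rcases Int.eq_one_or_neg_one_of_mul_eq_one' h1 with h | h
      · exact h.2
      · omega
    rw [h2] at h1
    linarith
  rw [key j, hgi, sub_zero, one_mul]

theorem projective_pi {L : Type} [Fintype L] {M : L → Type} [∀ l, AddCommGroup (M l)]
    [∀ l, Module A (M l)] [∀ l, Module.Projective A (M l)] : Module.Projective A (∀ l, M l) := by
  classical
  exact Module.Projective.of_equiv (DFinsupp.linearEquivFunOnFintype (R := A) (M := M))

theorem projective_radLeft (h : IsAdmissiblePresentation K Q φ)
    (hirr : IsGeomIrreducible K Q φ) [FiniteDimensional K A]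
    (hfin : HasFiniteGlobalDimension A) (i : Q.V) :
    Module.Projective A (radLeft (arrowIdeal φ h.1) (φ (vertexElem K Q i))) := by
  have hb := h.isBasicData
  let e : Q.V → A := fun k => φ (vertexElem K Q k)
  let r := arrowIdeal φ h.1
  let R := radLeft r (e i)
  obtain ⟨m, hm⟩ := hfin
  obtain ⟨g, hg⟩ := hb.exists_dimension_eq_sum m R (hm (ModuleCat.of A R)).projDimLT
  choose n hn x hx hspan using fun j => exists_span_sup_of_le
    ((hb.smul_top_cornerIdeal_le (K := K) i j (M := R)).trans inf_le_left)
  have hgn := coeff_eq_of_isGeomIrreducible h hirr i g hg n hn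
  let κ : ((k : Q.V) × Fin (n k)) → Q.V := Sigma.fst
  have hs : Function.Surjective (IsBasicData.genMap e κ fun l => x l.1 l.2) := by
    refine hb.genMap_surjective κ (fun l => x l.1 l.2) (fun l => hx l.1 l.2) fun k y hy => ?_
    refine sup_le_sup ?_ ((hb.smul_top_cornerIdeal_le (K := K) i k (M := R)).trans inf_le_right)
      (hspan k hy)
    refine Submodule.span_mono ?_
    rintro _ ⟨t, rfl⟩
    exact ⟨⟨k, t⟩, rfl⟩
  have hker : LinearMap.ker (IsBasicData.genMap e κ fun l => x l.1 l.2) = ⊥ := by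
    have h0 : ∀ j, ∀ z : fixedSpace K (LinearMap.ker (IsBasicData.genMap e κ fun l => x l.1 l.2)) (e j),
        z = 0 := by
      intro j
      have h1 := finrank_fixedSpace_eq_add_ker (K := K) (hb.idem j) hs
      rw [finrank_fixedSpace_pi] at h1
      have h2 := sum_sigma_fin n fun k =>
        (Module.finrank K (fixedSpace K (projLeft (e k)) (e j)) : ℤ)
      have h3 := hg j
      simp only [hgn] at h3
      zify at h1
      have h4 : (Module.finrank K (fixedSpace K
          (LinearMap.ker (IsBasicData.genMap e κ fun l => x l.1 l.2)) (e j)) : ℤ) = 0 := by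
        simp only [κ, e, R, r] at h1 h2 h3 ⊢
        linarith
      have h5 : Subsingleton (fixedSpace K
          (LinearMap.ker (IsBasicData.genMap e κ fun l => x l.1 l.2)) (e j)) :=
        (Module.finrank_zero_iff (R := K)).1 (Int.natCast_eq_zero.1 h4)
      exact fun z => Subsingleton.elim _ _
    refine (Submodule.eq_bot_iff _).2 fun z hz => ?_
    let z' : LinearMap.ker (IsBasicData.genMap e κ fun l => x l.1 l.2) := ⟨z, hz⟩
    have h1 : z' = 0 := by
      rw [← hb.sum_smul z']
      refine Finset.sum_eq_zero fun j _ => ?_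
      exact congrArg Subtype.val (h0 j ⟨_, smul_mem_fixedSpace (hb.idem j) z'⟩)
    exact congrArg Subtype.val h1
  have : ∀ l, Module.Projective A (projLeft (e (κ l))) := fun l =>
    projective_projLeft (hb.idem _)
  have := projective_pi (A := A) (M := fun l => projLeft (e (κ l)))
  exact Module.Projective.of_equiv
    (LinearEquiv.ofBijective _ ⟨LinearMap.ker_eq_bot.1 hker, hs⟩)

end Hereditary

section ProjectiveDimension

variable {K A V : Type} [Field K] [Ring A] [Algebra K A] [Fintype V]
variable {e : V → A} {r : Submodule A A}

namespace IsBasicData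

theorem isInternal_fixedSpace [DecidableEq V] (h : IsBasicData K e r) (M : Type) [AddCommGroup M]
    [Module K M] [Module A M] [IsScalarTower K A M] :
    DirectSum.IsInternal fun k => fixedSpace K M (e k) := by
  rw [DirectSum.isInternal_submodule_iff_iSupIndep_and_iSup_eq_top]
  constructor
  · intro k
    rw [Submodule.disjoint_def]
    intro m hm hm'
    let f : M →ₗ[K] M :=
      { toFun := fun m => e k • m
        map_add' := smul_add _
        map_smul' := fun c m => smul_comm _ c m }
    have hle : ⨆ j, ⨆ (_ : j ≠ k), fixedSpace K M (e j) ≤ LinearMap.ker f := by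
      refine iSup₂_le fun j hj y hy => ?_
      change e k • y = 0
      rw [← mem_fixedSpace.1 hy, ← mul_smul, h.orth k j hj.symm, zero_smul]
    exact (mem_fixedSpace.1 hm).symm.trans (hle hm')
  · refine eq_top_iff.2 fun m _ => ?_
    rw [← h.sum_smul m]
    exact Submodule.sum_mem _ fun k _ => Submodule.mem_iSup_of_mem k
      (smul_mem_fixedSpace (h.idem k) m)

theorem projDimLT_two_of_smul_eq_zero (h : IsBasicData K e r)
    (hr : ∀ k, Module.Projective A (radLeft r (e k))) (M : Type) [AddCommGroup M] [Module A M]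
    (hM : ∀ a ∈ r, ∀ m : M, a • m = 0) : ProjDimLT A M 2 := by
  classical
  let _ : Module K M := Module.compHom M (algebraMap K A)
  have : IsScalarTower K A M := IsScalarTower.of_algebraMap_smul fun _ _ => rfl
  let β := (h.isInternal_fixedSpace (M := M)).collectedBasis
    fun k => Module.Basis.ofVectorSpace K (fixedSpace K M (e k))
  let X := (k : V) × Module.Basis.ofVectorSpaceIndex K (fixedSpace K M (e k))
  have hβ : ∀ x : X, e x.1 • β x = β x := by
    intro x
    exact (h.isInternal_fixedSpace (M := M)).collectedBasis_mem _ x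
  let π : (Π₀ x : X, projLeft (e x.1)) →ₗ[A] M :=
    DFinsupp.lsum ℕ fun x => (LinearMap.toSpanSingleton A M (β x)) ∘ₗ (projLeft (e x.1)).subtype
  have hπ₁ : ∀ x a, π (DFinsupp.single x a) = (a : A) • β x := by
    intro x a
    simp [π]
  have hπ : ∀ f, π f = ∑ x ∈ f.support, (f x : A) • β x := by
    intro f
    conv_lhs => rw [← DFinsupp.sum_single (f := f), DFinsupp.sum, map_sum]
    exact Finset.sum_congr rfl fun x _ => hπ₁ x _
  have hc : ∀ k (a : projLeft (e k)), ∃ c : K, (a : A) - c • e k ∈ r := fun k a =>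
    h.exists_smul_sub_mem a.2
  choose c hc using hc
  have hcβ : ∀ (x : X) (a : projLeft (e x.1)), (a : A) • β x = c x.1 a • β x := by
    intro x a
    have := hM _ (hc x.1 a) (β x)
    rwa [sub_smul, smul_assoc, hβ, sub_eq_zero] at this
  have hs : Function.Surjective π := by
    intro m
    refine ⟨∑ x ∈ (β.repr m).support,
      DFinsupp.single x (β.repr m x • ⟨e x.1, h.idem x.1⟩), ?_⟩
    rw [map_sum]
    conv_rhs => rw [← β.linearCombination_repr m, Finsupp.linearCombination_apply, Finsupp.sum]
    refine Finset.sum_congr rfl fun x _ => ?_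
    rw [hπ₁]
    change (β.repr m x • e x.1) • β x = _
    rw [smul_assoc, hβ]
  let ι : (Π₀ x : X, radLeft r (e x.1)) →ₗ[A] (Π₀ x : X, projLeft (e x.1)) :=
    DFinsupp.mapRange.linearMap fun x => (radLeft r (e x.1)).subtype
  have hι : Function.Injective ι := by
    intro f g hfg
    refine DFinsupp.ext fun x => Subtype.ext ?_
    exact DFunLike.congr_fun hfg x
  have hker : LinearMap.range ι = LinearMap.ker π := by
    apply le_antisymm
    · rintro _ ⟨f, rfl⟩
      rw [LinearMap.mem_ker, hπ]
      exact Finset.sum_eq_zero fun x _ => hM _ (f x).2 _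
    · intro f hf
      rw [LinearMap.mem_ker, hπ] at hf
      simp only [hcβ] at hf
      have h0 := linearIndependent_iff'.1 β.linearIndependent f.support (fun x => c x.1 (f x)) hf
      rw [← DFinsupp.sum_single (f := f)]
      refine Submodule.sum_mem _ fun x hx => ?_
      have hfx : (f x : A) ∈ r := by
        have := hc x.1 (f x)
        rwa [h0 x hx, zero_smul, sub_zero] at this
      refine ⟨DFinsupp.single x ⟨f x, hfx⟩, ?_⟩
      simp [ι]
  have hP : ∀ k, Module.Projective A (projLeft (e k)) := fun k => projective_projLeft (h.idem k)
  refine projDimLT_of_ker hs ?_ (projDimLT_of_projective 1)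
  exact ProjDimLT.of_equiv (M := Π₀ x : X, radLeft r (e x.1)) ((LinearEquiv.ofInjective ι hι).trans (LinearEquiv.ofEq _ _ hker))
    (projDimLT_of_projective 0)

theorem projDimLT_two (h : IsBasicData K e r)
    (hr : ∀ k, Module.Projective A (radLeft r (e k))) (M : Type) [AddCommGroup M] [Module A M] :
    ProjDimLT A M 2 := by
  obtain ⟨n, hn⟩ := h.nilpotent
  have hM : ∀ a ∈ (r.restrictScalars K) ^ n, ∀ m : M, a • m = 0 := by
    intro a ha m
    rw [hn, Submodule.mem_bot] at ha
    rw [ha, zero_smul]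
  clear hn
  induction n generalizing M with
  | zero =>
    have : Subsingleton M := by
      refine subsingleton_of_forall_eq 0 fun m => ?_
      rw [← one_smul A m]
      exact hM 1 (by rw [pow_zero]; exact Submodule.one_le.1 le_rfl) m
    exact projDimLT_of_projective 1
  | succ n ih =>
    let N : Submodule A M := Submodule.span A {m | ∃ b ∈ r, ∃ y : M, b • y = m}
    have hN : ProjDimLT A N 2 := by
      refine ih N fun a ha y => Subtype.ext ?_
      change a • (y : M) = 0
      refine Submodule.closure_induction (p := fun y _ => a • y = 0) (smul_zero a)
        (fun y z _ _ hy hz => by rw [smul_add, hy, hz, add_zero]) ?_ y.2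
      rintro s _ ⟨b, hb, y, rfl⟩
      rw [← mul_smul, ← mul_smul, mul_assoc]
      refine hM _ ?_ y
      rw [pow_succ]
      exact Submodule.mul_mem_mul ha (r.smul_mem s hb)
    refine projDimLT_extension (Submodule.mkQ_surjective N) ?_
      (h.projDimLT_two_of_smul_eq_zero hr (M ⧸ N) fun a ha m => ?_)
    · rwa [Submodule.ker_mkQ]
    · obtain ⟨m, rfl⟩ := Submodule.mkQ_surjective N m
      rw [← map_smul]
      exact (Submodule.Quotient.mk_eq_zero N).2 (Submodule.subset_span ⟨a, ha, m, rfl⟩)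

end IsBasicData
end ProjectiveDimension

section Main

theorem isHereditaryRing_of_isGeomIrreducible {K : Type} [Field K] {Q : FinQuiver} {A : Type}
    [Ring A] [Algebra K A] [FiniteDimensional K A] {φ : PathAlgebra K Q →ₐ[K] A}
    (h : IsAdmissiblePresentation K Q φ) (hirr : IsGeomIrreducible K Q φ)
    (hfin : HasFiniteGlobalDimension A) : IsHereditaryRing A := fun M =>
  ProjDimLT.hasProjDimLE_one
    (h.isBasicData.projDimLT_two (projective_radLeft h hirr hfin) M)

end Main

/-- Let `A = KQ/I` be a finite-dimensional algebra over an algebraically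
closed field `K`, where `Q` is a finite quiver and `I` is an admissible ideal of `KQ`, and
assume that `A` has finite global dimension.  Then `A` is geometrically irreducible if and
only if `A` is hereditary (i.e. the global dimension of `A` is at most `1`). -/
theorem geomIrreducible_iff_hereditary_of_finite_globalDimension [IsAlgClosed K]
    (A : Type) [Ring A] [Algebra K A] [Module.Finite K A]
    (φ : PathAlgebra K Q →ₐ[K] A) (hadm : IsAdmissiblePresentation K Q φ)
    (hfin : HasFiniteGlobalDimension A) :
    IsGeomIrreducible K Q φ ↔ IsHereditaryRing A := by
  exact ⟨fun h => isHereditaryRing_of_isGeomIrreducible hadm h hfin,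
    isGeomIrreducible_of_isHereditaryRing hadm⟩
end
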